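/- arXiv:0811.1173 — 7 statements merged into one kernel-verified Lean document; each statement's English description precedes it below -/
import Mathlib

section
/- Let f_0 be a C^∞ diffeomorphism of [0,∞) with f_0(0) = 0 and 0 < f_0(x) < x for x > 0, generated as the time-1 flow of a complete C^∞ vector field ξ_0 on [0,∞) which vanishes only at 0 and satisfies sup(|ξ_0| + |Dξ_0|) < ∞. Assume the oscillation condition limsup_{x→0⁺} ( sup_{0<y≤x} |log(x − f_0(x))| / |log(y − f_0(y))| ) = +∞. Let ψ(t) = f_0^t(1) for t ∈ ℝ (where f_0^t is the flow of ξ_0), a_l = ψ(l), and V_l = [a_{l+2}, a_{l-2}] for l ≥ 2. Then there exist two sequences of integers (i(n))_{n≥0} and (j(n))_{n≥0} with i(n) < j(n) < i(n+1) for all n, such that, setting u_n = sup_{V_{i(n)}} |ξ_0| and v_n = inf_{V_{j(n)}} |ξ_0|, one has (log u_n)/(log v_n) → +∞ as n → ∞; in particular V_{i(n)} and V_{j(n)} are disjoint for n large enough. -/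
open Set Filter Topology

/-- `f` is a diffeomorphism of the half-line `[0,∞)`: it fixes `0`, maps `[0,∞)` bijectively
onto itself, is differentiable (in the sense of `[0,∞)`) with everywhere positive derivative,
and its inverse is differentiable. -/
def HalfLineDiffeo (f : ℝ → ℝ) : Prop :=
  f 0 = 0 ∧ Set.BijOn f (Set.Ici 0) (Set.Ici 0) ∧
    (∀ x ∈ Set.Ici (0 : ℝ), ∃ d : ℝ, 0 < d ∧ HasDerivWithinAt f d (Set.Ici 0) x) ∧
    (∀ y ∈ Set.Ici (0 : ℝ), ∃ d : ℝ,
      HasDerivWithinAt (Function.invFunOn f (Set.Ici 0)) d (Set.Ici 0) y)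

/-- `f` is a `C^r` diffeomorphism of `[0,∞)`. -/
def CrHalfLineDiffeo (r : ℕ∞) (f : ℝ → ℝ) : Prop :=
  HalfLineDiffeo f ∧ ContDiffOn ℝ r f (Set.Ici 0)

/-- The `C^r` centralizer of `f` : all `C^r` diffeomorphisms of `[0,∞)` commuting with `f`. -/
def Centralizer (r : ℕ∞) (f : ℝ → ℝ) : Set (ℝ → ℝ) :=
  {g | CrHalfLineDiffeo r g ∧ ∀ x ∈ Set.Ici (0 : ℝ), g (f x) = f (g x)}

/-- `F` is the (complete, globally defined) flow of the vector field `ξ` on `[0,∞)`: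
`F 0 x = x` and `∂ₜ F t x = ξ (F t x)` for all `t ∈ ℝ` and `x ∈ [0,∞)`. -/
def IsFlowOf (ξ : ℝ → ℝ) (F : ℝ → ℝ → ℝ) : Prop :=
  ∀ x ∈ Set.Ici (0 : ℝ), F 0 x = x ∧
    ∀ t : ℝ, F t x ∈ Set.Ici (0 : ℝ) ∧ HasDerivAt (fun s => F s x) (ξ (F t x)) t

/-- Two global solutions in `[0,∞)` of an autonomous Lipschitz equation which agree at time `0`
are equal. -/
lemma eq_of_hasDerivAt_of_lipschitzOnWith_Ici {ξ : ℝ → ℝ} {K : NNReal}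
    (hK : LipschitzOnWith K ξ (Ici 0)) {φ χ : ℝ → ℝ}
    (hφ : ∀ t, φ t ∈ Ici (0 : ℝ) ∧ HasDerivAt φ (ξ (φ t)) t)
    (hχ : ∀ t, χ t ∈ Ici (0 : ℝ) ∧ HasDerivAt χ (ξ (χ t)) t) {t₀ : ℝ} (h : φ t₀ = χ t₀) :
    φ = χ :=
  ODE_solution_unique_univ (v := fun _ => ξ) (s := fun _ => Ici 0) (K := K) (fun _ => hK)
    (fun t => (hφ t).symm) (fun t => (hχ t).symm) h

/-- A function with bounded `derivWithin` on `[0,∞)` is Lipschitz there. -/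
lemma exists_lipschitzOnWith_Ici {ξ : ℝ → ℝ} (hd : DifferentiableOn ℝ ξ (Ici 0)) {C : ℝ}
    (hC : ∀ x ∈ Ici (0 : ℝ), |derivWithin ξ (Ici 0) x| ≤ C) :
    ∃ K : NNReal, LipschitzOnWith K ξ (Ici 0) := by
  refine ⟨C.toNNReal, (convex_Ici 0).lipschitzOnWith_of_nnnorm_derivWithin_le hd fun x hx => ?_⟩
  rw [← norm_toNNReal]
  exact Real.toNNReal_le_toNNReal (hC x hx)

lemma IsFlowOf.add {ξ : ℝ → ℝ} {F : ℝ → ℝ → ℝ} (hF : IsFlowOf ξ F) {K : NNReal}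
    (hK : LipschitzOnWith K ξ (Ici 0)) {x : ℝ} (hx : x ∈ Ici (0 : ℝ)) (s t : ℝ) :
    F (t + s) x = F t (F s x) := by
  have hs := ((hF x hx).2 s).1
  refine congrFun (eq_of_hasDerivAt_of_lipschitzOnWith_Ici hK (φ := fun t => F (t + s) x)
    (χ := fun t => F t (F s x)) (t₀ := 0) (fun t => ⟨((hF x hx).2 _).1, ?_⟩)
    (fun t => (hF _ hs).2 t) ?_) t
  · exact ((hF x hx).2 (t + s)).2.comp_add_const t s
  · simp [(hF _ hs).1]

lemma IsFlowOf.pos {ξ : ℝ → ℝ} {F : ℝ → ℝ → ℝ} (hF : IsFlowOf ξ F) {K : NNReal}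
    (hK : LipschitzOnWith K ξ (Ici 0)) (h0 : ξ 0 = 0) {x : ℝ} (hx : 0 < x) (t : ℝ) :
    0 < F t x := by
  refine lt_of_le_of_ne ((hF x hx.le).2 t).1 fun h => hx.ne' ?_
  have := eq_of_hasDerivAt_of_lipschitzOnWith_Ici hK (φ := fun t => F t x) (χ := fun _ => 0)
    (t₀ := t) (fun t => (hF x hx.le).2 t)
    (fun t => ⟨self_mem_Ici, by simpa [h0] using hasDerivAt_const t (0 : ℝ)⟩) h.symm
  rw [← (hF x hx.le).1]
  exact congrFun this 0

/-- Along a positive trajectory of a vector field with derivative bounded by `C`, the logarithm of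
the speed is `C`-Lipschitz in time. -/
lemma abs_log_sub_log_le_of_trajectory {ξ : ℝ → ℝ} (hd : DifferentiableOn ℝ ξ (Ici 0)) {C : ℝ}
    (hC : ∀ x ∈ Ici (0 : ℝ), |derivWithin ξ (Ici 0) x| ≤ C) (hne : ∀ x, 0 < x → ξ x ≠ 0)
    {ψ : ℝ → ℝ} (hpos : ∀ t, 0 < ψ t) (hψ : ∀ t, HasDerivAt ψ (ξ (ψ t)) t) (s t : ℝ) :
    |Real.log (ξ (ψ t)) - Real.log (ξ (ψ s))| ≤ C * |t - s| := by
  have key : ∀ t ∈ (univ : Set ℝ), HasDerivWithinAt (fun t => Real.log (ξ (ψ t)))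
      (derivWithin ξ (Ici 0) (ψ t)) univ t := by
    intro t _
    have h1 : HasDerivAt ξ (derivWithin ξ (Ici 0) (ψ t)) (ψ t) :=
      ((hd _ (hpos t).le).hasDerivWithinAt).hasDerivAt (Ici_mem_nhds (hpos t))
    have h2 := (h1.comp t (hψ t)).log (hne _ (hpos t))
    rw [Function.comp_apply, mul_div_cancel_right₀ _ (hne _ (hpos t))] at h2
    exact h2.hasDerivWithinAt
  exact convex_univ.norm_image_sub_le_of_norm_hasDerivWithin_le key
    (fun t _ => hC _ (hpos t).le) (mem_univ s) (mem_univ t)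

lemma log_sSup_le_of_forall_log_le {S : Set ℝ} (hS : S.Nonempty) {M : ℝ}
    (h : ∀ z ∈ S, 0 < z ∧ Real.log z ≤ M) : Real.log (sSup S) ≤ M := by
  have hle : ∀ z ∈ S, z ≤ Real.exp M := fun z hz =>
    (Real.log_le_iff_le_exp (h z hz).1).1 (h z hz).2
  obtain ⟨z, hz⟩ := hS
  exact (Real.log_le_iff_le_exp ((h z hz).1.trans_le (le_csSup ⟨_, hle⟩ hz))).2
    (csSup_le ⟨z, hz⟩ hle)

lemma log_sInf_mem_Icc_of_forall_log_mem {S : Set ℝ} (hS : S.Nonempty) {m M : ℝ}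
    (h : ∀ z ∈ S, 0 < z ∧ Real.log z ∈ Icc m M) : Real.log (sInf S) ∈ Icc m M := by
  have hle : ∀ z ∈ S, Real.exp m ≤ z := fun z hz =>
    (Real.le_log_iff_exp_le (h z hz).1).1 (h z hz).2.1
  have hm : Real.exp m ≤ sInf S := le_csInf hS hle
  have hpos := (Real.exp_pos m).trans_le hm
  obtain ⟨z, hz⟩ := hS
  exact ⟨(Real.le_log_iff_exp_le hpos).2 hm,
    (Real.log_le_log hpos (csInf_le ⟨_, hle⟩ hz)).trans (h z hz).2.2⟩

/-- If the logarithm of the speed of a trajectory is `C`-Lipschitz in time, then it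
oscillates by at most `6 * C` between a time `c` and the times in `[l - 2, l + 2]`, for `l` the
integer part of a time `s ∈ [c - 1, c]`. -/
lemma log_mem_Icc_of_mem_image {ξ ψ : ℝ → ℝ} {C : ℝ} (hC0 : 0 ≤ C) (hcont : Continuous ψ)
    (hne : ∀ t, ξ (ψ t) ≠ 0)
    (hlip : ∀ s t, |Real.log (ξ (ψ t)) - Real.log (ξ (ψ s))| ≤ C * |t - s|)
    {s c : ℝ} (hc : c ∈ Ioo s (s + 1)) {z : ℝ}
    (hz : z ∈ (fun x => |ξ x|) '' Icc (ψ ((⌊s⌋ + 2 : ℤ) : ℝ)) (ψ ((⌊s⌋ - 2 : ℤ) : ℝ))) :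
    0 < z ∧ Real.log z ∈
      Icc (Real.log (ξ (ψ c)) - 6 * C) (Real.log (ξ (ψ c)) + 6 * C) := by
  obtain ⟨x, hx, rfl⟩ := hz
  have hle : ((⌊s⌋ - 2 : ℤ) : ℝ) ≤ ((⌊s⌋ + 2 : ℤ) : ℝ) := by push_cast; linarith
  obtain ⟨t, ht, rfl⟩ := intermediate_value_Icc' hle hcont.continuousOn hx
  have h1 := Int.floor_le s
  have h2 := Int.lt_floor_add_one s
  push_cast at ht
  have h3 : |t - c| ≤ 6 := abs_le.2 ⟨by linarith [ht.1, hc.2], by linarith [ht.2, hc.1]⟩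
  have h4 := abs_le.1 ((hlip c t).trans (mul_le_mul_of_nonneg_left h3 hC0))
  refine ⟨abs_pos.2 (hne t), ?_⟩
  rw [Real.log_abs]
  constructor <;> linarith [h4.1, h4.2]

/-- Sequences `i 0 < j 0 < i 1 < j 1 < ⋯` satisfying `P n (i n) (j n)` can be chosen one pair at a
time. -/
lemma exists_interleaved {P : ℕ → ℤ → ℤ → Prop}
    (h : ∀ (n : ℕ) (N : ℤ), ∃ i j, N < i ∧ i < j ∧ P n i j) :
    ∃ i j : ℕ → ℤ, (∀ n, i n < j n ∧ j n < i (n + 1)) ∧ ∀ n, P n (i n) (j n) := by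
  choose p q hp hpq hP using h
  let J : ℕ → ℤ := fun n => Nat.rec 0 (fun n N => q n N) n
  exact ⟨fun n => p n (J n), fun n => q n (J n),
    fun n => ⟨hpq n _, hp (n + 1) (J (n + 1))⟩, fun n => hP n _⟩

/-- Elementary comparison: perturbing two large negative logarithms `A`, `B` by at most `k`
changes their quotient by a factor at most `4`. -/
lemma div_four_le_div_of_perturb {A B U W k M : ℝ} (hk : 0 < k) (hA : 2 * k ≤ -A)
    (hB : 2 * k ≤ -B) (hM : M * -B ≤ -A) (hU : U ≤ A + k) (hW : W ∈ Icc (B - k) (B + k))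
    (hM0 : 0 ≤ M) :
    M / 4 ≤ U / W := by
  have hWneg : 0 < -W := by linarith [hW.2]
  rw [← neg_div_neg_eq U W, le_div_iff₀ hWneg]
  have h1 : -W ≤ 2 * -B := by linarith [hW.1]
  nlinarith [mul_le_mul_of_nonneg_left h1 hM0]

/-- Lemma on the orbit of a contracting diffeomorphism satisfying the oscillation condition:
there are interleaved sequences of integers `i(n) < j(n) < i(n+1)` such that, with
`u_n = sup_{V_{i(n)}} |ξ₀|` and `v_n = inf_{V_{j(n)}} |ξ₀|` (`V_l = [a_{l+2}, a_{l-2}]`),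
one has `log u_n / log v_n → +∞`; in particular `V_{i(n)}` and `V_{j(n)}` are eventually
disjoint. -/
theorem statement6 (f₀ : ℝ → ℝ)
    (hf₀ : CrHalfLineDiffeo ⊤ f₀) (hf₀0 : f₀ 0 = 0)
    (hf₀_contr : ∀ x : ℝ, 0 < x → 0 < f₀ x ∧ f₀ x < x)
    (ξ₀ : ℝ → ℝ) (F₀ : ℝ → ℝ → ℝ)
    (hξ₀_smooth : ContDiffOn ℝ ((⊤ : ℕ∞) : WithTop ℕ∞) ξ₀ (Set.Ici 0))
    (hξ₀0 : ξ₀ 0 = 0) (hξ₀_ne : ∀ x : ℝ, 0 < x → ξ₀ x ≠ 0)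
    (hξ₀_bdd : ∃ C : ℝ, ∀ x ∈ Set.Ici (0 : ℝ),
      |ξ₀ x| + |derivWithin ξ₀ (Set.Ici 0) x| ≤ C)
    (hF₀ : IsFlowOf ξ₀ F₀)
    (hF₀1 : ∀ x ∈ Set.Ici (0 : ℝ), F₀ 1 x = f₀ x)
    (hosc : ∀ M : ℝ, ∀ ε : ℝ, 0 < ε → ∃ x : ℝ, 0 < x ∧ x < ε ∧
      ∃ y : ℝ, 0 < y ∧ y ≤ x ∧
        M < |Real.log (x - f₀ x)| / |Real.log (y - f₀ y)|)
    (ψ : ℝ → ℝ) (hψ : ∀ t : ℝ, ψ t = F₀ t 1)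
    (a : ℤ → ℝ) (ha : ∀ l : ℤ, a l = ψ (l : ℝ))
    (V : ℤ → Set ℝ) (hV : ∀ l : ℤ, V l = Set.Icc (a (l + 2)) (a (l - 2))) :
    ∃ i j : ℕ → ℤ,
      (∀ n : ℕ, 2 ≤ i n) ∧
      (∀ n : ℕ, i n < j n ∧ j n < i (n + 1)) ∧
      Filter.Tendsto (fun n : ℕ =>
          Real.log (sSup ((fun x => |ξ₀ x|) '' V (i n))) /
            Real.log (sInf ((fun x => |ξ₀ x|) '' V (j n))))
        Filter.atTop Filter.atTop ∧
      (∀ᶠ n : ℕ in Filter.atTop, Disjoint (V (i n)) (V (j n))) := by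
  obtain ⟨C, hC⟩ := hξ₀_bdd
  have hC' : ∀ x ∈ Ici (0 : ℝ), |derivWithin ξ₀ (Ici 0) x| ≤ C := fun x hx =>
    (le_add_of_nonneg_left (abs_nonneg _)).trans (hC x hx)
  have hC0 : 0 ≤ C := (abs_nonneg _).trans (hC' 0 self_mem_Ici)
  have hd : DifferentiableOn ℝ ξ₀ (Ici 0) := hξ₀_smooth.differentiableOn (by simp)
  obtain ⟨K, hK⟩ := exists_lipschitzOnWith_Ici hd hC'
  have h1mem : (1 : ℝ) ∈ Ici (0 : ℝ) := mem_Ici.2 zero_le_one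
  obtain rfl : ψ = fun t => F₀ t 1 := funext hψ
  set ψ : ℝ → ℝ := fun t => F₀ t 1 with hψdef
  have hψpos : ∀ t, 0 < ψ t := hF₀.pos hK hξ₀0 one_pos
  have hψd : ∀ t, HasDerivAt ψ (ξ₀ (ψ t)) t := fun t => ((hF₀ 1 h1mem).2 t).2
  have hψ0 : ψ 0 = 1 := (hF₀ 1 h1mem).1
  have hψne : ∀ t, ξ₀ (ψ t) ≠ 0 := fun t => hξ₀_ne _ (hψpos t)
  have hψcont : Continuous ψ := continuous_iff_continuousAt.2 fun t => (hψd t).continuousAt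
  have hstep : ∀ t, ψ (t + 1) = f₀ (ψ t) := fun t => by
    rw [← hF₀1 _ (hψpos t).le, add_comm]
    exact hF₀.add hK h1mem t 1
  have hslope : ∀ s, ∃ c ∈ Ioo s (s + 1), -ξ₀ (ψ c) = ψ s - f₀ (ψ s) := fun s => by
    obtain ⟨c, hc, h⟩ := exists_hasDerivAt_eq_slope ψ (fun t => ξ₀ (ψ t)) (lt_add_one s)
      hψcont.continuousOn fun t _ => hψd t
    refine ⟨c, hc, ?_⟩
    rw [h, hstep]
    ring
  have hneg : ∀ t, ξ₀ (ψ t) < 0 := by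
    rcases hasDerivWithinAt_forall_lt_or_forall_gt_of_forall_ne convex_univ
      (fun t _ => (hψd t).hasDerivWithinAt) (fun t _ => hψne t) with h | h
    · exact fun t => h t (mem_univ t)
    · obtain ⟨c, -, hc⟩ := hslope 0
      linarith [h c (mem_univ c), (hf₀_contr _ (hψpos 0)).2]
  have hanti : StrictAnti ψ := strictAnti_of_hasDerivAt_neg hψd hneg
  have hlim : Tendsto ψ atTop (𝓝 0) := by
    have hL := tendsto_atTop_ciInf hanti.antitone
      ⟨0, by rintro _ ⟨t, rfl⟩; exact (hψpos t).le⟩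
    set L := ⨅ t, ψ t
    have hL0 : L ∈ Ici (0 : ℝ) := ge_of_tendsto' hL fun t => (hψpos t).le
    have h1 : Tendsto (fun t => f₀ (ψ t)) atTop (𝓝 (f₀ L)) :=
      (hf₀.2.continuousOn L hL0).tendsto.comp
        (tendsto_nhdsWithin_iff.2 ⟨hL, Eventually.of_forall fun t => (hψpos t).le⟩)
    have h2 : Tendsto (fun t => f₀ (ψ t)) atTop (𝓝 L) := by
      simpa only [Function.comp_def, id, hstep] using
        hL.comp (tendsto_atTop_add_const_right atTop (1 : ℝ) tendsto_id)
    have h3 : f₀ L = L := tendsto_nhds_unique h1 h2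
    rcases eq_or_lt_of_le (show 0 ≤ L from hL0) with h | h
    · rwa [← h] at hL
    · linarith [(hf₀_contr L h).2]
  have hsurj : ∀ x, 0 < x → x ≤ 1 → ∃ s, ψ s = x := fun x hx hx1 => by
    obtain ⟨S, hSx, hS0⟩ := ((hlim.eventually_lt_const hx).and (eventually_ge_atTop 0)).exists
    obtain ⟨s, -, hs⟩ := intermediate_value_Icc' hS0 hψcont.continuousOn
      ⟨hSx.le, hx1.trans hψ0.ge⟩
    exact ⟨s, hs⟩
  have hlip := abs_log_sub_log_le_of_trajectory hd hC' hξ₀_ne hψpos hψd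
  obtain ⟨k, hkdef⟩ : ∃ k, k = 6 * C + 1 := ⟨_, rfl⟩
  have hk : 0 < k := by linarith
  have hVimage : ∀ l : ℤ, (fun x => |ξ₀ x|) '' V l =
      (fun x => |ξ₀ x|) '' Icc (ψ ((l + 2 : ℤ) : ℝ)) (ψ ((l - 2 : ℤ) : ℝ)) := fun l => by
    rw [hV, ha, ha]
  have hVne : ∀ l : ℤ, ((fun x => |ξ₀ x|) '' V l).Nonempty := fun l => by
    rw [hVimage]
    exact (nonempty_Icc.2 (hanti.antitone (by push_cast; linarith))).image _
  have hpair : ∀ (n : ℕ) (N : ℤ), ∃ i j : ℤ, max N 1 < i ∧ i < j ∧ (i + 4 < j ∧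
      (n : ℝ) ≤ Real.log (sSup ((fun x => |ξ₀ x|) '' V i)) /
        Real.log (sInf ((fun x => |ξ₀ x|) '' V j))) := by
    intro n N
    obtain ⟨x, hx, hxε, y, hy, hyx, hxy⟩ := hosc (4 * n + 4)
      (min (min 1 (Real.exp (-(2 * k)))) (ψ ((max N 1 : ℤ) + 1)))
      (lt_min (lt_min one_pos (Real.exp_pos _)) (hψpos _))
    obtain ⟨⟨hx1, hxk⟩, hxN⟩ : (x < 1 ∧ x < Real.exp (-(2 * k))) ∧ x < ψ ((max N 1 : ℤ) + 1) := by
      simpa only [lt_min_iff] using hxε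
    have hlog : ∀ w, 0 < w → w ≤ x → Real.log (w - f₀ w) ≤ -(2 * k) := fun w hw hwx => by
      have := hf₀_contr w hw
      rw [Real.log_le_iff_le_exp (by linarith)]
      linarith
    have hA := hlog x hx le_rfl
    have hB := hlog y hy hyx
    obtain ⟨s, rfl⟩ := hsurj x hx hx1.le
    obtain ⟨t, rfl⟩ := hsurj y hy (hyx.trans hx1.le)
    obtain ⟨c, hc, hcs⟩ := hslope s
    obtain ⟨d, hd, hdt⟩ := hslope t
    rw [← hcs, Real.log_neg_eq_log] at hxy hA
    rw [← hdt, Real.log_neg_eq_log] at hxy hB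
    have hst : s ≤ t := hanti.le_iff_ge.1 hyx
    have hNs : ((max N 1 : ℤ) : ℝ) + 1 < s := hanti.lt_iff_gt.1 hxN
    rw [abs_of_neg (by linarith), abs_of_neg (by linarith), lt_div_iff₀ (by linarith)] at hxy
    have hfar : ⌊s⌋ + 4 < ⌊t⌋ := by
      by_contra! hle
      have hle' : (⌊t⌋ : ℝ) ≤ ⌊s⌋ + 4 := by exact_mod_cast hle
      have hcd : |c - d| ≤ 6 := abs_le.2
        ⟨by linarith [hc.1, hd.2, Int.floor_le s, Int.lt_floor_add_one t],
          by linarith [hc.2, hd.1]⟩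
      have h1 := (abs_le.1 ((hlip d c).trans (mul_le_mul_of_nonneg_left hcd hC0))).1
      have h2 : 0 ≤ (n : ℝ) * -Real.log (ξ₀ (ψ d)) := mul_nonneg n.cast_nonneg (by linarith)
      nlinarith
    have hNfloor : max N 1 < ⌊s⌋ := by
      rw [← Int.add_one_le_iff, Int.le_floor]
      push_cast at hNs ⊢
      exact hNs.le
    refine ⟨⌊s⌋, ⌊t⌋, hNfloor, by linarith, hfar, ?_⟩
    have hU : Real.log (sSup ((fun x => |ξ₀ x|) '' V ⌊s⌋)) ≤ Real.log (ξ₀ (ψ c)) + k := by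
      refine log_sSup_le_of_forall_log_le (hVne _) fun z hz => ?_
      rw [hVimage] at hz
      have := log_mem_Icc_of_mem_image hC0 hψcont hψne hlip hc hz
      exact ⟨this.1, by linarith [this.2.2]⟩
    have hW : Real.log (sInf ((fun x => |ξ₀ x|) '' V ⌊t⌋)) ∈
        Icc (Real.log (ξ₀ (ψ d)) - k) (Real.log (ξ₀ (ψ d)) + k) := by
      refine log_sInf_mem_Icc_of_forall_log_mem (hVne _) fun z hz => ?_
      rw [hVimage] at hz
      have := log_mem_Icc_of_mem_image hC0 hψcont hψne hlip hd hz
      exact ⟨this.1, by linarith [this.2.1], by linarith [this.2.2]⟩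
    have := div_four_le_div_of_perturb hk (by linarith) (by linarith) hxy.le hU hW (by positivity)
    linarith
  obtain ⟨i, j, hij, hP⟩ := exists_interleaved
    (P := fun n i j => 2 ≤ i ∧ i + 4 < j ∧
      (n : ℝ) ≤ Real.log (sSup ((fun x => |ξ₀ x|) '' V i)) /
        Real.log (sInf ((fun x => |ξ₀ x|) '' V j))) fun n N => by
      obtain ⟨i, j, hNi, h⟩ := hpair n N
      exact ⟨i, j, (le_max_left _ _).trans_lt hNi, h.1, (le_max_right N 1).trans_lt hNi, h.2⟩
  refine ⟨i, j, fun n => (hP n).1, hij,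
    tendsto_atTop_mono (fun n => (hP n).2.2) tendsto_natCast_atTop_atTop,
    Eventually.of_forall fun n => ?_⟩
  rw [hV, hV, ha, ha, ha, ha, Set.disjoint_left]
  rintro x ⟨hx, -⟩ ⟨-, hx'⟩
  have : ψ ((j n - 2 : ℤ) : ℝ) < ψ ((i n + 2 : ℤ) : ℝ) :=
    hanti (by exact_mod_cast (by linarith [(hP n).2.1] : i n + 2 < j n - 2))
  linarith
end

section
/- The Sergeraert vector field ξ_0 is well defined (the two formulas agree at the endpoints 2^{−n}) and has the following properties: ξ_0 is C^∞ on [0,∞); ξ_0(x) < 0 for all x > 0; ξ_0 is infinitely flat at the origin, i.e. D^m ξ_0(0) = 0 for all m ≥ 0; 1 < sup{ |ξ_0(x)|, |Dξ_0(x)| : x ≥ 0 } < +∞; ξ_0 is complete; and ξ_0 is identically equal to −v_n on [2^{−n−1} + 2^{−n−1}/3, 2^{−n} − 2^{−n−1}/3] and identically equal to −u_n on [2^{−n} − 2^{−n−1}/6, 2^{−n} + 2^{−n}/6], for every n ≥ 0. -/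
open Set Filter Topology

noncomputable def uSeq (n : ℕ) : ℝ := (2 : ℝ) ^ (-((n : ℤ) ^ 4))
noncomputable def vSeq (n : ℕ) : ℝ := (2 : ℝ) ^ (-((n : ℤ) ^ 2))
noncomputable def wSeq (n : ℕ) : ℝ := (2 : ℝ) ^ (-((n : ℤ) ^ 3))

/-- The pair of auxiliary plateau functions `α, β` used to define the Sergeraert field. -/
def IsBumpPair (α β : ℝ → ℝ) : Prop :=
  ContDiff ℝ ((⊤ : ℕ∞) : WithTop ℕ∞) α ∧ ContDiff ℝ ((⊤ : ℕ∞) : WithTop ℕ∞) β ∧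
  (∀ t : ℝ, α t ∈ Set.Icc (0 : ℝ) 1) ∧ (∀ t : ℝ, β t ∈ Set.Icc (0 : ℝ) 1) ∧
  (∀ t : ℝ, t ≤ 1 / 6 → α t = 0) ∧ (∀ t : ℝ, 1 / 3 ≤ t → α t = 1) ∧
  (∀ t : ℝ, t ≤ 1 / 6 → β t = 0) ∧ (∀ t : ℝ, 5 / 6 ≤ t → β t = 0) ∧
  (∀ t ∈ Set.Icc (1 / 3 : ℝ) (2 / 3), β t = 1)

/-- The defining equations of the Sergeraert vector field `ξ₀` built from `α` and `β`. -/
def IsSergeraertField (α β ξ₀ : ℝ → ℝ) : Prop :=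
  ξ₀ 0 = 0 ∧ (∀ x : ℝ, 1 ≤ x → ξ₀ x = -1) ∧
  ∀ n : ℕ, ∀ x ∈ Set.Icc ((2 : ℝ) ^ (-(n : ℤ) - 1)) ((2 : ℝ) ^ (-(n : ℤ))),
    ξ₀ x = -uSeq (n + 1) - (uSeq n - uSeq (n + 1)) * α ((2 : ℝ) ^ (n + 1) * x - 1)
      - (vSeq n - uSeq n) * β ((2 : ℝ) ^ (n + 1) * x - 1)

lemma vSeq_pos (n : ℕ) : 0 < vSeq n := by unfold vSeq; positivity

lemma uSeq_pos (n : ℕ) : 0 < uSeq n := by unfold uSeq; positivity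

lemma uSeq_le_vSeq (n : ℕ) : uSeq n ≤ vSeq n := by
  unfold uSeq vSeq
  apply zpow_le_zpow_right₀ (by norm_num)
  rcases n.eq_zero_or_pos with rfl | hn
  · simp
  · exact neg_le_neg (by exact_mod_cast Nat.pow_le_pow_right hn (by norm_num))

lemma uSeq_succ_le (n : ℕ) : uSeq (n + 1) ≤ uSeq n := by
  unfold uSeq
  apply zpow_le_zpow_right₀ (by norm_num)
  exact neg_le_neg (by gcongr; simp)

/-- `v n` decays faster than any exponential. -/
lemma summable_two_pow_pow_mul_vSeq (k : ℕ) :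
    Summable fun n : ℕ => ((2 : ℝ) ^ (n + 1)) ^ k * vSeq n := by
  refine Summable.of_norm_bounded_eventually_nat (g := fun n : ℕ => (2 : ℝ) ^ k * (1 / 2) ^ n)
    (summable_geometric_two.mul_left _) ?_
  filter_upwards [eventually_ge_atTop (k + 1)] with n hn
  rw [Real.norm_of_nonneg (mul_nonneg (by positivity) (vSeq_pos n).le)]
  have h1 : ((2 : ℝ) ^ (n + 1)) ^ k * vSeq n = 2 ^ (((n : ℤ) + 1) * k - (n : ℤ) ^ 2) := by
    unfold vSeq
    rw [← pow_mul, ← zpow_natCast, ← zpow_add₀ (by norm_num)]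
    push_cast
    ring_nf
  have h2 : (2 : ℝ) ^ k * (1 / 2) ^ n = 2 ^ ((k : ℤ) - n) := by
    rw [zpow_sub₀ (by norm_num)]
    simp [div_eq_mul_inv]
  rw [h1, h2]
  apply zpow_le_zpow_right₀ (by norm_num)
  have : (k : ℤ) + 1 ≤ n := by exact_mod_cast hn
  nlinarith

lemma summable_vSeq : Summable vSeq := by
  simpa using summable_two_pow_pow_mul_vSeq 0

lemma tendsto_uSeq : Tendsto uSeq atTop (𝓝 0) :=
  squeeze_zero (fun n => (uSeq_pos n).le) uSeq_le_vSeq summable_vSeq.tendsto_atTop_zero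

/-- A smooth function that is constant on either side of `[0,1]` has bounded derivatives. -/
lemma exists_bound_iteratedDeriv {f : ℝ → ℝ} (hf : ContDiff ℝ ((⊤ : ℕ∞) : WithTop ℕ∞) f)
    {a b : ℝ} (ha : ∀ x ≤ 0, f x = a) (hb : ∀ x, 1 ≤ x → f x = b) (m : ℕ) :
    ∃ C, ∀ x, |iteratedDeriv m f x| ≤ C := by
  have hcont : Continuous (iteratedDeriv m f) :=
    hf.continuous_iteratedDeriv m (by exact_mod_cast le_top)
  obtain ⟨C, hC⟩ := isCompact_Icc.exists_bound_of_continuousOn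
    (s := Icc (0 : ℝ) 1) hcont.continuousOn
  have hconst : ∀ {c x : ℝ}, f =ᶠ[𝓝 x] (fun _ => c) → |iteratedDeriv m f x| ≤ |c| := by
    intro c x h
    rw [h.iteratedDeriv_eq, iteratedDeriv_const]
    split_ifs <;> simp
  refine ⟨max C (max |a| |b|), fun x => ?_⟩
  rcases lt_or_ge x 0 with h0 | h0
  · refine (hconst (c := a) ?_).trans (by simp)
    filter_upwards [Iio_mem_nhds h0] with y hy using ha y (le_of_lt hy)
  rcases lt_or_ge 1 x with h1 | h1
  · refine (hconst (c := b) ?_).trans (by simp)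
    filter_upwards [Ioi_mem_nhds h1] with y hy using hb y (le_of_lt hy)
  · exact (hC x ⟨h0, h1⟩).trans (le_max_left _ _)

/-- Superposing dilates of a plateau function with coefficients dominated by `v n`
gives a smooth function. -/
lemma contDiff_tsum_dilate {f : ℝ → ℝ} (hf : ContDiff ℝ ((⊤ : ℕ∞) : WithTop ℕ∞) f)
    {a b : ℝ} (ha : ∀ x ≤ 0, f x = a) (hb : ∀ x, 1 ≤ x → f x = b) {c : ℕ → ℝ}
    (hc : ∀ n, |c n| ≤ vSeq n) :
    ContDiff ℝ ((⊤ : ℕ∞) : WithTop ℕ∞) fun x => ∑' n : ℕ, c n * f (2 ^ (n + 1) * x - 1) := by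
  choose C hC using exists_bound_iteratedDeriv hf ha hb
  refine contDiff_tsum (v := fun k n => C k * (((2 : ℝ) ^ (n + 1)) ^ k * vSeq n)) ?_ ?_ ?_
  · intro n
    fun_prop
  · intro k _
    exact (summable_two_pow_pow_mul_vSeq k).mul_left _
  · intro k n x hk
    have hf' : ContDiff ℝ k f := hf.of_le (by exact_mod_cast le_top)
    have hg : ContDiff ℝ k fun y => f (y - 1) := by fun_prop
    rw [norm_iteratedFDeriv_eq_norm_iteratedDeriv, iteratedDeriv_const_mul_field,
      iteratedDeriv_comp_const_mul (f := fun y => f (y - 1)) hg, iteratedDeriv_comp_sub_const,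
      Real.norm_eq_abs, abs_mul, abs_mul, abs_of_pos (by positivity : (0 : ℝ) < (2 ^ (n + 1)) ^ k)]
    calc |c n| * ((2 ^ (n + 1)) ^ k * |iteratedDeriv k f (2 ^ (n + 1) * x - 1)|)
        ≤ vSeq n * ((2 ^ (n + 1)) ^ k * C k) := by
          gcongr
          · exact (vSeq_pos n).le
          · exact hc n
          · exact hC k _
      _ = C k * ((2 ^ (n + 1)) ^ k * vSeq n) := by ring

/-- A bounded Lipschitz vector field on the line has globally defined integral curves. -/
lemma exists_integralCurve_of_lipschitz_of_bounded {ξ : ℝ → ℝ} {K L : NNReal}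
    (hK : LipschitzWith K ξ) (hL : ∀ x, |ξ x| ≤ L) (x : ℝ) :
    ∃ γ : ℝ → ℝ, γ 0 = x ∧ ∀ t, HasDerivAt γ (ξ (γ t)) t := by
  have key : ∀ a : NNReal, 0 < a → ∃ γ : ℝ → ℝ, γ 0 = x ∧
      ∀ t ∈ Ioo (-a : ℝ) a, HasDerivAt γ (ξ (γ t)) t := by
    intro a ha
    have ha' : (0 : ℝ) ≤ a := a.2
    have hPL : IsPicardLindelof (fun _ : ℝ => ξ) (tmin := -a) (tmax := a)
        ⟨0, by simp, by simp⟩ x (L * a) 0 L K :=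
      { lipschitzOnWith := fun _ _ => hK.lipschitzOnWith
        continuousOn := fun _ _ => continuousOn_const
        norm_le := fun _ _ y _ => hL y
        mul_max_le := by simp }
    obtain ⟨γ, h0, h⟩ := hPL.exists_eq_forall_mem_Icc_hasDerivWithinAt₀
    exact ⟨γ, h0, fun t ht =>
      (h t (Ioo_subset_Icc_self ht)).hasDerivAt (Icc_mem_nhds ht.1 ht.2)⟩
  choose γ hγ0 hγ using fun n : ℕ => key (n + 1) (by positivity)
  push_cast at hγ
  have agree : ∀ m n : ℕ, m ≤ n → EqOn (γ m) (γ n) (Ioo (-(m + 1 : ℝ)) (m + 1)) := by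
    intro m n hmn
    have hmn' : (m : ℝ) ≤ n := by exact_mod_cast hmn
    refine ODE_solution_unique_of_mem_Ioo (v := fun _ => ξ) (s := fun _ => univ) (K := K) (t₀ := 0)
      (fun _ _ => hK.lipschitzOnWith) ⟨by linarith [m.cast_nonneg (α := ℝ)], by positivity⟩
      (fun t ht => ⟨hγ m t ht, mem_univ _⟩)
      (fun t ht => ⟨hγ n t ⟨by linarith [ht.1], by linarith [ht.2]⟩, mem_univ _⟩)
      (by rw [hγ0, hγ0])
  have agree' : ∀ (n : ℕ) (t : ℝ), t ∈ Ioo (-(n + 1 : ℝ)) (n + 1) → γ ⌈|t|⌉₊ t = γ n t := by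
    intro n t ht
    have hmem : t ∈ Ioo (-(⌈|t|⌉₊ + 1 : ℝ)) (⌈|t|⌉₊ + 1) :=
      abs_lt.1 ((Nat.le_ceil _).trans_lt (lt_add_one _))
    rcases le_total ⌈|t|⌉₊ n with h | h
    · exact agree _ _ h hmem
    · exact (agree _ _ h ht).symm
  refine ⟨fun t => γ ⌈|t|⌉₊ t, by simp [hγ0], fun t => ?_⟩
  have hmem : t ∈ Ioo (-(⌈|t|⌉₊ + 1 : ℝ)) (⌈|t|⌉₊ + 1) :=
    abs_lt.1 ((Nat.le_ceil _).trans_lt (lt_add_one _))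
  refine (hγ ⌈|t|⌉₊ t hmem).congr_of_eventuallyEq ?_
  filter_upwards [Ioo_mem_nhds hmem.1 hmem.2] with s hs using agree' _ s hs

/-- Integral curves of a Lipschitz field vanishing at `0` do not leave `[0,∞)`. -/
lemma integralCurve_nonneg {ξ : ℝ → ℝ} {K : NNReal} (hK : LipschitzWith K ξ) (h0 : ξ 0 = 0)
    {γ : ℝ → ℝ} (hγ : ∀ t, HasDerivAt γ (ξ (γ t)) t) {t₀ : ℝ} (ht₀ : 0 ≤ γ t₀) (t : ℝ) :
    0 ≤ γ t := by
  by_contra! hneg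
  have hcont : Continuous γ := continuous_iff_continuousAt.2 fun s => (hγ s).continuousAt
  obtain ⟨s, hs⟩ : (0 : ℝ) ∈ range γ :=
    mem_range_of_exists_le_of_exists_ge hcont ⟨t, hneg.le⟩ ⟨t₀, ht₀⟩
  have : γ = fun _ => 0 :=
    ODE_solution_unique_univ (v := fun _ => ξ) (s := fun _ => univ) (K := K) (t₀ := s)
      (fun _ => hK.lipschitzOnWith) (fun r => ⟨hγ r, mem_univ _⟩)
      (fun r => ⟨by simpa [h0] using hasDerivAt_const r (0 : ℝ), mem_univ _⟩) hs
  simp [this] at hneg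

lemma exists_isFlowOf_of_lipschitz_of_bounded {ξ : ℝ → ℝ} {K L : NNReal}
    (hK : LipschitzWith K ξ) (hL : ∀ x, |ξ x| ≤ L) (h0 : ξ 0 = 0) :
    ∃ F : ℝ → ℝ → ℝ, IsFlowOf ξ F := by
  choose γ hγ0 hγ using exists_integralCurve_of_lipschitz_of_bounded hK hL
  refine ⟨fun t x => γ x t, fun x hx => ⟨hγ0 x, fun t => ⟨?_, hγ x t⟩⟩⟩
  exact integralCurve_nonneg hK h0 (hγ x) (t₀ := 0) (by rw [hγ0]; exact hx) t

/-- The Sergeraert field written as a superposition of dilated plateau functions. -/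
noncomputable def sergeraertField (α β : ℝ → ℝ) (x : ℝ) : ℝ :=
  -(∑' n : ℕ, (uSeq n - uSeq (n + 1)) * α (2 ^ (n + 1) * x - 1))
    - ∑' n : ℕ, (vSeq n - uSeq n) * β (2 ^ (n + 1) * x - 1)

section sergeraertField

variable {α β : ℝ → ℝ}

lemma abs_uSeq_sub_le (n : ℕ) : |uSeq n - uSeq (n + 1)| ≤ vSeq n := by
  rw [abs_of_nonneg (by linarith [uSeq_succ_le n])]
  linarith [uSeq_le_vSeq n, uSeq_pos (n + 1)]

lemma abs_vSeq_sub_uSeq_le (n : ℕ) : |vSeq n - uSeq n| ≤ vSeq n := by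
  rw [abs_of_nonneg (by linarith [uSeq_le_vSeq n])]
  linarith [uSeq_pos n]

lemma contDiff_sergeraertField (h : IsBumpPair α β) :
    ContDiff ℝ ((⊤ : ℕ∞) : WithTop ℕ∞) (sergeraertField α β) := by
  obtain ⟨hα, hβ, -, -, hα0, hα1, hβ0, hβ1, -⟩ := h
  exact (contDiff_tsum_dilate hα (a := 0) (b := 1) (fun x hx => hα0 x (by linarith))
      (fun x hx => hα1 x (by linarith)) abs_uSeq_sub_le).neg.sub
    (contDiff_tsum_dilate hβ (a := 0) (b := 0) (fun x hx => hβ0 x (by linarith))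
      (fun x hx => hβ1 x (by linarith)) abs_vSeq_sub_uSeq_le)

lemma sergeraertField_of_nonpos (h : IsBumpPair α β) {x : ℝ} (hx : x ≤ 0) :
    sergeraertField α β x = 0 := by
  obtain ⟨-, -, -, -, hα0, -, hβ0, -, -⟩ := h
  have hle : ∀ n : ℕ, (2 : ℝ) ^ (n + 1) * x - 1 ≤ 1 / 6 := fun n => by
    have := mul_nonpos_of_nonneg_of_nonpos (by positivity : (0 : ℝ) ≤ 2 ^ (n + 1)) hx
    linarith
  simp [sergeraertField, hα0 _ (hle _), hβ0 _ (hle _)]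

lemma summable_uSeq_sub_mul (h : IsBumpPair α β) (x : ℝ) :
    Summable fun n : ℕ => (uSeq n - uSeq (n + 1)) * α (2 ^ (n + 1) * x - 1) := by
  obtain ⟨-, -, hα, -⟩ := h
  refine Summable.of_norm_bounded summable_vSeq fun n => ?_
  rw [norm_mul, Real.norm_eq_abs, Real.norm_eq_abs, abs_of_nonneg (hα _).1]
  exact (mul_le_of_le_one_right (abs_nonneg _) (hα _).2).trans (abs_uSeq_sub_le n)

lemma sergeraertField_of_one_le (h : IsBumpPair α β) {x : ℝ} (hx : 1 ≤ x) :
    sergeraertField α β x = -1 := by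
  have hs := (summable_uSeq_sub_mul h x).hasSum.tendsto_sum_nat
  obtain ⟨-, -, -, -, -, hα1, -, hβ1, -⟩ := h
  have hge : ∀ n : ℕ, 1 ≤ (2 : ℝ) ^ (n + 1) * x - 1 := fun n => by
    have h2 : (1 : ℝ) ≤ 2 ^ n := one_le_pow₀ (by norm_num)
    rw [pow_succ]
    nlinarith
  have hA : ∀ n : ℕ, α (2 ^ (n + 1) * x - 1) = 1 := fun n => hα1 _ (by linarith [hge n])
  have hB : ∀ n : ℕ, β (2 ^ (n + 1) * x - 1) = 0 := fun n => hβ1 _ (by linarith [hge n])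
  have hlim : ∑' n : ℕ, (uSeq n - uSeq (n + 1)) * α (2 ^ (n + 1) * x - 1) = 1 - 0 := by
    refine tendsto_nhds_unique hs ?_
    have hu0 : uSeq 0 = 1 := by simp [uSeq]
    simp only [hA, mul_one, Finset.sum_range_sub', hu0]
    exact tendsto_const_nhds.sub tendsto_uSeq
  rw [sergeraertField, hlim]
  simp [hB]

lemma sergeraertField_of_mem_Icc (h : IsBumpPair α β) (k : ℕ) {x : ℝ}
    (hx : x ∈ Icc ((2 : ℝ) ^ (-(k : ℤ) - 1)) ((2 : ℝ) ^ (-(k : ℤ)))) :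
    sergeraertField α β x = -uSeq (k + 1) - (uSeq k - uSeq (k + 1)) * α ((2 : ℝ) ^ (k + 1) * x - 1)
      - (vSeq k - uSeq k) * β ((2 : ℝ) ^ (k + 1) * x - 1) := by
  have hs := (summable_uSeq_sub_mul h x).hasSum.tendsto_sum_nat
  obtain ⟨-, -, -, -, hα0, hα1, hβ0, hβ1, -⟩ := h
  have hlt : ∀ n : ℕ, n < k → (2 : ℝ) ^ (n + 1) * x - 1 ≤ 0 := fun n hn => by
    have : (2 : ℝ) ^ (n + 1) * x ≤ 2 ^ (k : ℤ) * 2 ^ (-(k : ℤ)) := by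
      rw [zpow_natCast]
      have hx0 : 0 ≤ x := le_trans (by positivity) hx.1
      gcongr
      · norm_num
      · exact hn
      · exact hx.2
    rw [← zpow_add₀ (by norm_num)] at this
    simp at this
    linarith
  have hgt : ∀ n : ℕ, k < n → 1 ≤ (2 : ℝ) ^ (n + 1) * x - 1 := fun n hn => by
    have : (2 : ℝ) ^ ((k : ℤ) + 2) * 2 ^ (-(k : ℤ) - 1) ≤ (2 : ℝ) ^ (n + 1) * x := by
      rw [show (k : ℤ) + 2 = ((k + 2 : ℕ) : ℤ) by push_cast; ring, zpow_natCast]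
      exact mul_le_mul (pow_le_pow_right₀ (by norm_num) (by omega)) hx.1
        (by positivity) (by positivity)
    rw [← zpow_add₀ (by norm_num)] at this
    norm_num [show (k : ℤ) + 2 + (-(k : ℤ) - 1) = 1 by ring] at this
    linarith
  have hB : ∑' n : ℕ, (vSeq n - uSeq n) * β (2 ^ (n + 1) * x - 1) =
      (vSeq k - uSeq k) * β (2 ^ (k + 1) * x - 1) := by
    refine tsum_eq_single k fun n hn => ?_
    rcases hn.lt_or_gt with hn | hn
    · rw [hβ0 _ (by linarith [hlt n hn]), mul_zero]
    · rw [hβ1 _ (by linarith [hgt n hn]), mul_zero]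
  have hA : ∑' n : ℕ, (uSeq n - uSeq (n + 1)) * α (2 ^ (n + 1) * x - 1) =
      (uSeq k - uSeq (k + 1)) * α (2 ^ (k + 1) * x - 1) + uSeq (k + 1) - 0 := by
    refine tendsto_nhds_unique hs ?_
    refine (tendsto_const_nhds.sub tendsto_uSeq).congr' ?_
    filter_upwards [eventually_ge_atTop (k + 1)] with N hN
    induction N, hN using Nat.le_induction with
    | base =>
      rw [Finset.sum_range_succ, Finset.sum_eq_zero]
      · ring
      · intro n hn
        rw [hα0 _ (by linarith [hlt n (Finset.mem_range.1 hn)]), mul_zero]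
    | succ N hN ih =>
      rw [Finset.sum_range_succ, ← ih, hα1 (2 ^ (N + 1) * x - 1) (by linarith [hgt N hN])]
      ring
  rw [sergeraertField, hA, hB]
  ring

lemma isSergeraertField_sergeraertField (h : IsBumpPair α β) :
    IsSergeraertField α β (sergeraertField α β) :=
  ⟨sergeraertField_of_nonpos h le_rfl, fun _ => sergeraertField_of_one_le h,
    fun k _ => sergeraertField_of_mem_Icc h k⟩

lemma sergeraertField_neg (h : IsBumpPair α β) {x : ℝ} (hx : 0 < x) :
    sergeraertField α β x < 0 := by
  rcases le_total 1 x with h1 | h1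
  · rw [sergeraertField_of_one_le h h1]
    norm_num
  obtain ⟨n, hn, hn'⟩ :=
    exists_nat_pow_near_of_lt_one hx h1 (by norm_num : (0 : ℝ) < 2⁻¹) (by norm_num)
  rw [sergeraertField_of_mem_Icc h n ⟨?_, ?_⟩]
  · obtain ⟨-, -, hα, hβ, -⟩ := h
    have h1 := mul_nonneg (sub_nonneg.2 (uSeq_succ_le n)) (hα (2 ^ (n + 1) * x - 1)).1
    have h2 := mul_nonneg (sub_nonneg.2 (uSeq_le_vSeq n)) (hβ (2 ^ (n + 1) * x - 1)).1
    linarith [uSeq_pos (n + 1)]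
  · rw [show -(n : ℤ) - 1 = -((n + 1 : ℕ) : ℤ) by push_cast; ring, zpow_neg, zpow_natCast, ← inv_pow]
    exact hn.le
  · rw [zpow_neg, zpow_natCast, ← inv_pow]
    exact hn'

lemma iteratedDerivWithin_sergeraertField_zero (h : IsBumpPair α β) (m : ℕ) :
    iteratedDerivWithin m (sergeraertField α β) (Ici 0) 0 = 0 := by
  have hs : ContDiffAt ℝ m (sergeraertField α β) 0 :=
    (contDiff_sergeraertField h).contDiffAt.of_le (by exact_mod_cast le_top)
  rw [iteratedDerivWithin_eq_iteratedDeriv (uniqueDiffOn_Ici 0) hs self_mem_Ici,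
    ← iteratedDerivWithin_eq_iteratedDeriv (uniqueDiffOn_Iic 0) hs self_mem_Iic,
    iteratedDerivWithin_congr (g := fun _ => 0)
      (fun x (hx : x ∈ Iic 0) => sergeraertField_of_nonpos h hx) self_mem_Iic]
  simp

lemma exists_bound_iteratedDeriv_sergeraertField (h : IsBumpPair α β) (m : ℕ) :
    ∃ C, ∀ x, |iteratedDeriv m (sergeraertField α β) x| ≤ C :=
  exists_bound_iteratedDeriv (contDiff_sergeraertField h)
    (fun _ => sergeraertField_of_nonpos h) (fun _ => sergeraertField_of_one_le h) m

lemma derivWithin_Ici_sergeraertField (h : IsBumpPair α β) {x : ℝ} (hx : x ∈ Ici (0 : ℝ)) :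
    derivWithin (sergeraertField α β) (Ici 0) x = deriv (sergeraertField α β) x :=
  ((contDiff_sergeraertField h).differentiable (by simp) x).derivWithin
    (uniqueDiffOn_Ici 0 x hx)

lemma exists_deriv_sergeraertField_eq (h : IsBumpPair α β) :
    ∃ c ∈ Ici (0 : ℝ), deriv (sergeraertField α β) c = -6 := by
  have hd := (contDiff_sergeraertField h).differentiable (by simp)
  obtain ⟨c, hc, hc'⟩ := exists_deriv_eq_slope (sergeraertField α β)
    (by norm_num : (7 / 12 : ℝ) < 2 / 3) hd.continuous.continuousOn hd.differentiableOn
  refine ⟨c, by simp only [mem_Ici]; linarith [hc.1], hc'.trans ?_⟩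
  rw [sergeraertField_of_mem_Icc h 0 (by norm_num), sergeraertField_of_mem_Icc h 0 (by norm_num)]
  obtain ⟨-, -, -, -, hα0, hα1, -⟩ := h
  rw [hα1 _ (by norm_num), hα0 _ (by norm_num)]
  norm_num [uSeq, vSeq]

lemma exists_isFlowOf_sergeraertField (h : IsBumpPair α β) :
    ∃ F : ℝ → ℝ → ℝ, IsFlowOf (sergeraertField α β) F := by
  obtain ⟨L, hL⟩ := exists_bound_iteratedDeriv_sergeraertField h 0
  obtain ⟨K, hK⟩ := exists_bound_iteratedDeriv_sergeraertField h 1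
  simp only [iteratedDeriv_zero, iteratedDeriv_one] at hL hK
  have hLip : LipschitzWith K.toNNReal (sergeraertField α β) :=
    lipschitzWith_of_nnnorm_deriv_le ((contDiff_sergeraertField h).differentiable (by simp))
      fun x => by
        rw [← NNReal.coe_le_coe, coe_nnnorm]
        exact (hK x).trans (Real.le_coe_toNNReal K)
  exact exists_isFlowOf_of_lipschitz_of_bounded hLip
    (fun x => (hL x).trans (Real.le_coe_toNNReal L)) (sergeraertField_of_nonpos h le_rfl)

lemma sergeraertField_eq_neg_vSeq (h : IsBumpPair α β) (n : ℕ) {x : ℝ}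
    (hx : x ∈ Icc ((2 : ℝ) ^ (-(n : ℤ) - 1) + (2 : ℝ) ^ (-(n : ℤ) - 1) / 3)
      ((2 : ℝ) ^ (-(n : ℤ)) - (2 : ℝ) ^ (-(n : ℤ) - 1) / 3)) :
    sergeraertField α β x = -vSeq n := by
  have hp : (0 : ℝ) < 2 ^ (-(n : ℤ) - 1) := by positivity
  have he : (2 : ℝ) ^ (-(n : ℤ)) = 2 * 2 ^ (-(n : ℤ) - 1) := by
    rw [← zpow_one_add₀ (by norm_num)]
    ring_nf
  have hm : (2 : ℝ) ^ (n + 1) * 2 ^ (-(n : ℤ) - 1) = 1 := by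
    rw [← zpow_natCast, ← zpow_add₀ (by norm_num)]
    simp
  have hq : (0 : ℝ) < 2 ^ (n + 1) := by positivity
  obtain ⟨hx1, hx2⟩ := hx
  rw [sergeraertField_of_mem_Icc h n ⟨by linarith, by linarith⟩]
  obtain ⟨-, -, -, -, -, hα1, -, -, hβ⟩ := h
  rw [hα1 _ (by nlinarith), hβ _ ⟨by nlinarith, by nlinarith⟩]
  ring

lemma sergeraertField_eq_neg_uSeq (h : IsBumpPair α β) (n : ℕ) {x : ℝ}
    (hx : x ∈ Icc ((2 : ℝ) ^ (-(n : ℤ)) - (2 : ℝ) ^ (-(n : ℤ) - 1) / 6)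
      ((2 : ℝ) ^ (-(n : ℤ)) + (2 : ℝ) ^ (-(n : ℤ)) / 6)) :
    sergeraertField α β x = -uSeq n := by
  have hp : (0 : ℝ) < 2 ^ (-(n : ℤ) - 1) := by positivity
  have he : (2 : ℝ) ^ (-(n : ℤ)) = 2 * 2 ^ (-(n : ℤ) - 1) := by
    rw [← zpow_one_add₀ (by norm_num)]
    ring_nf
  have hm : (2 : ℝ) ^ (n + 1) * 2 ^ (-(n : ℤ) - 1) = 1 := by
    rw [← zpow_natCast, ← zpow_add₀ (by norm_num)]
    simp
  have hq : (0 : ℝ) < 2 ^ (n + 1) := by positivity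
  obtain ⟨hx1, hx2⟩ := hx
  rcases le_total x (2 ^ (-(n : ℤ))) with hle | hge
  · rw [sergeraertField_of_mem_Icc h n ⟨by linarith, hle⟩]
    obtain ⟨-, -, -, -, -, hα1, -, hβ1, -⟩ := h
    rw [hα1 _ (by nlinarith), hβ1 _ (by nlinarith)]
    ring
  cases n with
  | zero =>
    rw [sergeraertField_of_one_le h (by simpa using hge)]
    simp [uSeq]
  | succ k =>
    have hk : -((k + 1 : ℕ) : ℤ) = -(k : ℤ) - 1 := by push_cast; ring
    have he' : (2 : ℝ) ^ (-(k : ℤ)) = 2 * 2 ^ (-(k : ℤ) - 1) := by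
      rw [← zpow_one_add₀ (by norm_num)]
      ring_nf
    have hm' : (2 : ℝ) ^ (k + 1) * 2 ^ (-(k : ℤ) - 1) = 1 := by
      rw [← zpow_natCast, ← zpow_add₀ (by norm_num)]
      simp
    have hq' : (0 : ℝ) < 2 ^ (k + 1) := by positivity
    rw [hk] at hge hx2
    have hp' : (0 : ℝ) < 2 ^ (-(k : ℤ) - 1) := by positivity
    rw [sergeraertField_of_mem_Icc h k ⟨hge, by linarith⟩]
    obtain ⟨-, -, -, -, hα0, -, hβ0, -, -⟩ := h
    rw [hα0 _ (by nlinarith), hβ0 _ (by nlinarith)]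
    ring

end sergeraertField

/-- The Sergeraert vector field is well defined and is: smooth on `[0,∞)`, negative on
`(0,∞)`, infinitely flat at the origin, `C^1`-bounded with `1 < sup{|ξ₀|,|Dξ₀|} < ∞`,
complete, and equal to the plateau values `-v_n`, `-u_n` on the stated intervals. -/
theorem statement8 (α β : ℝ → ℝ) (hαβ : IsBumpPair α β) :
    ∃ ξ₀ : ℝ → ℝ, IsSergeraertField α β ξ₀ ∧
      ContDiffOn ℝ ((⊤ : ℕ∞) : WithTop ℕ∞) ξ₀ (Set.Ici 0) ∧
      (∀ x : ℝ, 0 < x → ξ₀ x < 0) ∧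
      (∀ m : ℕ, iteratedDerivWithin m ξ₀ (Set.Ici 0) 0 = 0) ∧
      BddAbove {y : ℝ | ∃ x ∈ Set.Ici (0 : ℝ),
        y = |ξ₀ x| ∨ y = |derivWithin ξ₀ (Set.Ici 0) x|} ∧
      1 < sSup {y : ℝ | ∃ x ∈ Set.Ici (0 : ℝ),
        y = |ξ₀ x| ∨ y = |derivWithin ξ₀ (Set.Ici 0) x|} ∧
      (∃ F : ℝ → ℝ → ℝ, IsFlowOf ξ₀ F) ∧
      (∀ n : ℕ,
        (∀ x ∈ Set.Icc ((2 : ℝ) ^ (-(n : ℤ) - 1) + (2 : ℝ) ^ (-(n : ℤ) - 1) / 3)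
            ((2 : ℝ) ^ (-(n : ℤ)) - (2 : ℝ) ^ (-(n : ℤ) - 1) / 3), ξ₀ x = -vSeq n) ∧
        (∀ x ∈ Set.Icc ((2 : ℝ) ^ (-(n : ℤ)) - (2 : ℝ) ^ (-(n : ℤ) - 1) / 6)
            ((2 : ℝ) ^ (-(n : ℤ)) + (2 : ℝ) ^ (-(n : ℤ)) / 6), ξ₀ x = -uSeq n)) := by
  have hbdd : BddAbove {y : ℝ | ∃ x ∈ Set.Ici (0 : ℝ), y = |sergeraertField α β x| ∨
      y = |derivWithin (sergeraertField α β) (Set.Ici 0) x|} := by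
    obtain ⟨L, hL⟩ := exists_bound_iteratedDeriv_sergeraertField hαβ 0
    obtain ⟨K, hK⟩ := exists_bound_iteratedDeriv_sergeraertField hαβ 1
    simp only [iteratedDeriv_zero, iteratedDeriv_one] at hL hK
    refine ⟨max L K, ?_⟩
    rintro y ⟨x, hx, rfl | rfl⟩
    · exact (hL x).trans (le_max_left _ _)
    · rw [derivWithin_Ici_sergeraertField hαβ hx]
      exact (hK x).trans (le_max_right _ _)
  refine ⟨sergeraertField α β, isSergeraertField_sergeraertField hαβ,
    (contDiff_sergeraertField hαβ).contDiffOn, fun x => sergeraertField_neg hαβ,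
    iteratedDerivWithin_sergeraertField_zero hαβ, hbdd, ?_,
    exists_isFlowOf_sergeraertField hαβ, fun n =>
      ⟨fun x => sergeraertField_eq_neg_vSeq hαβ n, fun x => sergeraertField_eq_neg_uSeq hαβ n⟩⟩
  obtain ⟨c, hc, hc'⟩ := exists_deriv_sergeraertField_eq hαβ
  have hle := le_csSup hbdd ⟨c, hc, Or.inr rfl⟩
  rw [derivWithin_Ici_sergeraertField hαβ hc, hc'] at hle
  refine lt_of_lt_of_le ?_ hle
  norm_num
end

section
/- Let q ≥ 1 be an integer, j ∈ ℤ, and w > 0 with w·q·‖γ‖₁ < 1. Define γ_{q,j,w}(t) = w·γ(q(t − j)) and the C^∞ diffeomorphism φ(t) = t + Σ_{p≥0} γ_{q,j,w}(t + p/q) of ℝ. For t ∈ ℝ set σ^t = φ^{-1} ∘ (id + t) ∘ φ. Then for every integer p ≥ 1 and every t ∈ ℝ: σ^{p/q}(t) = t + p/q + Σ_{r=0}^{p-1} γ_{q,j,w}(t + r/q). In particular, σ^{p/q}(t) = t + p/q for all t outside the interval [j + 1/(2q) − p/q, j + 1/(2q)], and for every m ≥ 0, ‖σ^{p/q} − (id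 + p/q)‖_m = ‖γ_{q,j,w}‖_m. -/
open Set Filter Topology

/-- `CmNorm m g = ‖g‖_m`, the supremum of `|D^i g|` over `0 ≤ i ≤ m` and all points. -/
noncomputable def CmNorm (m : ℕ) (g : ℝ → ℝ) : ℝ :=
  sSup {y : ℝ | ∃ i ≤ m, ∃ t : ℝ, y = |iteratedDeriv i g t|}

/-- `CiNorm i g = ‖D^i g‖₀`, the supremum of `|D^i g|` over all points. -/
noncomputable def CiNorm (i : ℕ) (g : ℝ → ℝ) : ℝ :=
  sSup {y : ℝ | ∃ t : ℝ, y = |iteratedDeriv i g t|}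

section BumpTranslates

variable {f : ℝ → ℝ} {c q : ℝ}

/-- Translates by distinct multiples of `1/q` of a window of length `1/(2q)` are disjoint. -/
lemma eq_of_add_div_mem_Icc (hq : 0 < q) {t : ℝ} {a b : ℕ}
    (ha : t + a / q ∈ Icc (c - 1 / (4 * q)) (c + 1 / (4 * q)))
    (hb : t + b / q ∈ Icc (c - 1 / (4 * q)) (c + 1 / (4 * q))) : a = b := by
  wlog h : a < b generalizing a b
  · rcases (not_lt.1 h).eq_or_lt with h | h
    · exact h.symm
    · exact (this hb ha h).symm
  exfalso
  have h1 : (a : ℝ) + 1 ≤ b := by exact_mod_cast h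
  have h2 : ((a : ℝ) + 1) / q ≤ b / q := by gcongr
  have h3 : 1 / (4 * q) = 1 / q / 4 := by field_simp
  have h4 : 0 < 1 / q := by positivity
  rw [add_div] at h2
  linarith [ha.1, hb.2]

/-- At each point, at most one of the translates of `f` by multiples of `1/q` is nonzero. -/
lemma exists_forall_ne_eq_zero (hq : 0 < q)
    (hf : ∀ t, t ∉ Icc (c - 1 / (4 * q)) (c + 1 / (4 * q)) → f t = 0) (t : ℝ) :
    ∃ n : ℕ, ∀ k : ℕ, k ≠ n → f (t + k / q) = 0 := by
  by_cases h : ∃ n : ℕ, t + n / q ∈ Icc (c - 1 / (4 * q)) (c + 1 / (4 * q))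
  · obtain ⟨n, hn⟩ := h
    exact ⟨n, fun k hk => hf _ fun hk' => hk (eq_of_add_div_mem_Icc hq hk' hn)⟩
  · push Not at h
    exact ⟨0, fun k _ => hf _ (h k)⟩

lemma summable_translates (hq : 0 < q)
    (hf : ∀ t, t ∉ Icc (c - 1 / (4 * q)) (c + 1 / (4 * q)) → f t = 0) (t : ℝ) :
    Summable fun k : ℕ => f (t + k / q) := by
  obtain ⟨n, hn⟩ := exists_forall_ne_eq_zero hq hf t
  exact (hasSum_single n hn).summable

lemma strictMono_add_tsum_translates (hq : 0 < q)
    (hf : ∀ t, t ∉ Icc (c - 1 / (4 * q)) (c + 1 / (4 * q)) → f t = 0) (hf0 : ∀ t, 0 ≤ f t)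
    {L : ℝ} (hL : L < 1) (hlip : ∀ s t, |f t - f s| ≤ L * |t - s|) :
    StrictMono fun t : ℝ => t + ∑' k : ℕ, f (t + k / q) := by
  intro s t hst
  obtain ⟨n, hn⟩ := exists_forall_ne_eq_zero hq hf s
  have h1 : ∑' k : ℕ, f (s + k / q) = f (s + n / q) := tsum_eq_single n hn
  have h2 : f (t + n / q) ≤ ∑' k : ℕ, f (t + k / q) :=
    (summable_translates hq hf t).le_tsum n fun _ _ => hf0 _
  have h3 := neg_le_of_abs_le (hlip (s + n / q) (t + n / q))
  rw [add_sub_add_right_eq_sub, abs_of_pos (sub_pos.2 hst)] at h3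
  have h4 : L * (t - s) < 1 * (t - s) := by gcongr
  simp only [h1]
  linarith

/-- Beyond the window, all forward translates of `f` vanish. -/
lemma translate_eq_zero_of_lt (hq : 0 < q)
    (hf : ∀ t, t ∉ Icc (c - 1 / (4 * q)) (c + 1 / (4 * q)) → f t = 0) {t : ℝ}
    (ht : c + 1 / (4 * q) < t) (k : ℕ) : f (t + k / q) = 0 := by
  have : (0 : ℝ) ≤ k / q := by positivity
  exact hf _ fun h => by linarith [h.2]

/-- The map `t ↦ t + Σ_{k ≥ 0} f (t + k/q)` intertwines `t ↦ t + p/q + Σ_{r < p} f (t + r/q)`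
with the translation by `p/q`. -/
lemma add_tsum_translates_semiconj (hq : 0 < q)
    (hf : ∀ t, t ∉ Icc (c - 1 / (4 * q)) (c + 1 / (4 * q)) → f t = 0) (hf0 : ∀ t, 0 ≤ f t)
    (p : ℕ) {u t : ℝ} (hu : u = t + p / q + ∑ r ∈ Finset.range p, f (t + r / q)) :
    u + ∑' k : ℕ, f (u + k / q) = t + ∑' k : ℕ, f (t + k / q) + p / q := by
  have hsplit : ∑ r ∈ Finset.range p, f (t + r / q) + ∑' k : ℕ, f (t + p / q + k / q) =
      ∑' k : ℕ, f (t + k / q) := by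
    rw [← (summable_translates hq hf t).sum_add_tsum_nat_add p]
    congr 2 with k
    push_cast
    congr 1
    ring
  suffices h : ∑' k : ℕ, f (u + k / q) = ∑' k : ℕ, f (t + p / q + k / q) by
    rw [h, ← hsplit, hu]
    ring
  by_cases h : ∃ r ∈ Finset.range p, f (t + r / q) ≠ 0
  · obtain ⟨r, hr, hne⟩ := h
    have hmem := not_imp_comm.1 (hf _) hne
    have h1 : (r : ℝ) + 1 ≤ p := by exact_mod_cast Finset.mem_range.1 hr
    have h2 : ((r : ℝ) + 1) / q ≤ p / q := by gcongr
    have h3 : 1 / (4 * q) = 1 / q / 4 := by field_simp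
    have h4 : 0 < 1 / q := by positivity
    rw [add_div] at h2
    have hlt : c + 1 / (4 * q) < t + p / q := by linarith [hmem.1]
    have hle : t + p / q ≤ u := by
      rw [hu]
      linarith [Finset.sum_nonneg fun r (_ : r ∈ Finset.range p) => hf0 (t + r / q)]
    simp [translate_eq_zero_of_lt hq hf hlt, translate_eq_zero_of_lt hq hf (hlt.trans_le hle)]
  · push Not at h
    rw [hu, Finset.sum_eq_zero h, add_zero]

lemma iteratedDeriv_eq_zero_of_notMem {K : Set ℝ} (hK : IsClosed K)
    (hf : ∀ t, t ∉ K → f t = 0) (i : ℕ) {t : ℝ} (ht : t ∉ K) : iteratedDeriv i f t = 0 := by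
  have h : f =ᶠ[𝓝 t] fun _ => 0 := by
    filter_upwards [hK.isOpen_compl.mem_nhds ht] with s hs using hf s hs
  rw [h.iteratedDeriv_eq i]
  simp

lemma cmNorm_sum_translates (hq : 0 < q) (hsm : ContDiff ℝ ((⊤ : ℕ∞) : WithTop ℕ∞) f)
    (hf : ∀ t, t ∉ Icc (c - 1 / (4 * q)) (c + 1 / (4 * q)) → f t = 0) {p : ℕ} (hp : 1 ≤ p)
    (m : ℕ) : CmNorm m (fun t => ∑ r ∈ Finset.range p, f (t + r / q)) = CmNorm m f := by
  have hD (i : ℕ) (t : ℝ) (ht : t ∉ Icc (c - 1 / (4 * q)) (c + 1 / (4 * q))) :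
      iteratedDeriv i f t = 0 := iteratedDeriv_eq_zero_of_notMem isClosed_Icc hf i ht
  have hsum (i : ℕ) (t : ℝ) : iteratedDeriv i (fun t => ∑ r ∈ Finset.range p, f (t + r / q)) t =
      ∑ r ∈ Finset.range p, iteratedDeriv i f (t + r / q) := by
    rw [iteratedDeriv_fun_sum]
    · simp only [iteratedDeriv_comp_add_const]
    · intro r _
      exact ((hsm.comp (contDiff_id.add contDiff_const)).of_le
        (by exact_mod_cast le_top)).contDiffAt
  unfold CmNorm
  congr 1
  ext y
  refine exists_congr fun i => and_congr_right fun _ => ?_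
  simp only [hsum]
  constructor
  · rintro ⟨t, rfl⟩
    obtain ⟨n, hn⟩ := exists_forall_ne_eq_zero hq (hD i) t
    by_cases hnp : n ∈ Finset.range p
    · exact ⟨t + n / q, by rw [Finset.sum_eq_single_of_mem n hnp fun k _ hk => hn k hk]⟩
    · refine ⟨t, ?_⟩
      have h0 := hn 0 (by rintro rfl; exact hnp (Finset.mem_range.2 hp))
      rw [Finset.sum_eq_zero fun k hk => hn k (by rintro rfl; exact hnp hk)]
      rw [show iteratedDeriv i f t = 0 by simpa using h0]
  · rintro ⟨t, rfl⟩
    by_cases ht : t ∈ Icc (c - 1 / (4 * q)) (c + 1 / (4 * q))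
    · refine ⟨t, ?_⟩
      rw [Finset.sum_eq_single_of_mem 0 (Finset.mem_range.2 hp)]
      · simp
      · intro k _ hk
        exact hD i _ fun hk' => hk (eq_of_add_div_mem_Icc hq hk' (by simpa using ht))
    · refine ⟨c + 1 / (4 * q) + 1, ?_⟩
      rw [hD i t ht, Finset.sum_eq_zero fun k _ =>
        translate_eq_zero_of_lt hq (hD i) (lt_add_one _) k]

end BumpTranslates

lemma abs_deriv_le_cmNorm_one {g : ℝ → ℝ} (hg : ContDiff ℝ ((⊤ : ℕ∞) : WithTop ℕ∞) g)
    (hc : HasCompactSupport g) (t : ℝ) : |deriv g t| ≤ CmNorm 1 g := by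
  have hg1 : ContDiff ℝ 1 g := hg.of_le (by exact_mod_cast le_top)
  obtain ⟨A, hA⟩ := hc.exists_bound_of_continuous hg.continuous
  obtain ⟨B, hB⟩ := hc.deriv.exists_bound_of_continuous (hg1.continuous_deriv le_rfl)
  refine le_csSup ⟨max A B, ?_⟩ ⟨1, le_rfl, t, by simp⟩
  rintro y ⟨i, hi, s, rfl⟩
  interval_cases i
  · simpa using Or.inl (hA s)
  · simpa using Or.inr (hB s)

/-- For the conjugated translation `σ^t = φ⁻¹ ∘ (id + t) ∘ φ`, one has
`σ^{p/q}(t) = t + p/q + Σ_{r=0}^{p-1} γ_{q,j,w}(t + r/q)`; in particular `σ^{p/q}` is the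
translation by `p/q` outside `[j + 1/(2q) − p/q, j + 1/(2q)]`, and
`‖σ^{p/q} − (id + p/q)‖_m = ‖γ_{q,j,w}‖_m` for every `m`. -/
theorem statement11
    (γ : ℝ → ℝ) (hγ_smooth : ContDiff ℝ ((⊤ : ℕ∞) : WithTop ℕ∞) γ)
    (hγ_range : ∀ t : ℝ, γ t ∈ Set.Icc (0 : ℝ) 1)
    (hγ_supp : ∀ t : ℝ, t ∉ Set.Icc (-(1 / 4) : ℝ) (1 / 4) → γ t = 0)
    (hγ_zero : ∀ᶠ t in 𝓝 (0 : ℝ), γ t = t ^ 2 / 2)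
    (q : ℕ) (hq : 1 ≤ q) (j : ℤ) (w : ℝ) (hw : 0 < w)
    (hsmall : w * (q : ℝ) * CmNorm 1 γ < 1)
    (γq φ : ℝ → ℝ)
    (hγq : ∀ t : ℝ, γq t = w * γ ((q : ℝ) * (t - (j : ℝ))))
    (hφ : ∀ t : ℝ, φ t = t + ∑' p : ℕ, γq (t + (p : ℝ) / (q : ℝ)))
    (σ : ℝ → ℝ → ℝ)
    (hσ : ∀ t s : ℝ, σ t s = Function.invFun φ (φ s + t)) :
    ∀ p : ℕ, 1 ≤ p →
      (∀ t : ℝ, σ ((p : ℝ) / (q : ℝ)) t =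
        t + (p : ℝ) / (q : ℝ) + ∑ r ∈ Finset.range p, γq (t + (r : ℝ) / (q : ℝ))) ∧
      (∀ t : ℝ,
        t ∉ Set.Icc ((j : ℝ) + 1 / (2 * q) - (p : ℝ) / (q : ℝ)) ((j : ℝ) + 1 / (2 * q)) →
        σ ((p : ℝ) / (q : ℝ)) t = t + (p : ℝ) / (q : ℝ)) ∧
      (∀ m : ℕ,
        CmNorm m (fun t => σ ((p : ℝ) / (q : ℝ)) t - (t + (p : ℝ) / (q : ℝ))) =
          CmNorm m γq) := by
  have hq0 : (0 : ℝ) < q := by exact_mod_cast hq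
  have hf : ∀ t, t ∉ Icc ((j : ℝ) - 1 / (4 * q)) (j + 1 / (4 * q)) → γq t = 0 := by
    intro t ht
    rw [hγq, hγ_supp _ fun h => ht ?_, mul_zero]
    have h1 : (q : ℝ) * (1 / (4 * q)) = 1 / 4 := by field_simp
    constructor
    · refine le_of_mul_le_mul_left ?_ hq0
      linarith [h.1]
    · refine le_of_mul_le_mul_left ?_ hq0
      linarith [h.2]
  have hf0 : ∀ t, 0 ≤ γq t := fun t => by
    rw [hγq]
    exact mul_nonneg hw.le (hγ_range _).1
  have hsm : ContDiff ℝ ((⊤ : ℕ∞) : WithTop ℕ∞) γq := by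
    rw [funext hγq]
    fun_prop
  have hγ_compact : HasCompactSupport γ := HasCompactSupport.intro isCompact_Icc hγ_supp
  have hlip : ∀ s t, |γq t - γq s| ≤ w * q * CmNorm 1 γ * |t - s| := by
    intro s t
    have h := convex_univ.norm_image_sub_le_of_norm_deriv_le (f := γ)
      (fun x _ => (hγ_smooth.differentiable (by simp)).differentiableAt)
      (fun x _ => abs_deriv_le_cmNorm_one hγ_smooth hγ_compact x)
      (mem_univ (q * (s - j))) (mem_univ (q * (t - j)))
    rw [Real.norm_eq_abs, Real.norm_eq_abs, ← mul_sub, sub_sub_sub_cancel_right, abs_mul,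
      abs_of_pos hq0] at h
    rw [hγq, hγq, ← mul_sub, abs_mul, abs_of_pos hw]
    calc w * |γ (q * (t - j)) - γ (q * (s - j))| ≤ w * (CmNorm 1 γ * (q * |t - s|)) := by gcongr
      _ = w * q * CmNorm 1 γ * |t - s| := by ring
  have hinj : Function.Injective φ := by
    rw [funext hφ]
    exact (strictMono_add_tsum_translates hq0 hf hf0 hsmall hlip).injective
  intro p hp
  have hmain : ∀ t : ℝ, σ (p / q) t =
      t + p / q + ∑ r ∈ Finset.range p, γq (t + r / q) := by
    intro t
    rw [hσ, hφ t, ← add_tsum_translates_semiconj hq0 hf hf0 p rfl, ← hφ]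
    exact Function.leftInverse_invFun hinj _
  refine ⟨hmain, fun t ht => ?_, fun m => ?_⟩
  · rw [hmain, Finset.sum_eq_zero, add_zero]
    intro r hr
    refine hf _ fun hmem => ht ?_
    have h1 : (r : ℝ) + 1 ≤ p := by exact_mod_cast Finset.mem_range.1 hr
    have h2 : ((r : ℝ) + 1) / q ≤ p / q := by gcongr
    have h3 : 1 / (4 * (q : ℝ)) = 1 / q / 4 := by field_simp
    have h4 : 1 / (2 * (q : ℝ)) = 1 / q / 2 := by field_simp
    have h5 : 0 < 1 / (q : ℝ) := by positivity
    have h6 : (0 : ℝ) ≤ r / q := by positivity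
    rw [add_div] at h2
    constructor <;> linarith [hmem.1, hmem.2]
  · simp only [hmain, add_sub_cancel_left]
    exact cmNorm_sum_translates hq0 hsm hf hp m
end

section
/- Let m ≥ 1 be an integer, let g: ℝ → ℝ be a C^m map with sup{ |D^i g(t)| : 1 ≤ i ≤ m, t ∈ ℝ } =: M < ∞, and let φ: ℝ → ℝ be a C^m map with ‖φ − id‖_m < ∞. Then ‖φ∘g − g‖_m ≤ |Π_m| · ‖φ − id‖_m · max(1, M)^m, where |Π_m| denotes the number of partitions of the set {1, …, m} (the m-th Bell number). -/
open Set Filter Topology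

namespace OrderedFinpartition

variable {n : ℕ}

/-- The `i`-th part of an ordered finpartition, as a finset. -/
def partFinset (c : OrderedFinpartition n) (i : Fin c.length) : Finset (Fin n) :=
  Finset.univ.image (c.emb i)

lemma mem_partFinset {c : OrderedFinpartition n} {i : Fin c.length} {x : Fin n} :
    x ∈ c.partFinset i ↔ ∃ r, c.emb i r = x := by
  simp [partFinset]

lemma card_partFinset (c : OrderedFinpartition n) (i : Fin c.length) :
    (c.partFinset i).card = c.partSize i := by
  rw [partFinset, Finset.card_image_of_injective _ (c.emb_strictMono i).injective]
  simp

lemma max_partFinset (c : OrderedFinpartition n) (i : Fin c.length) :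
    (c.partFinset i).max =
      (c.emb i ⟨c.partSize i - 1, Nat.sub_one_lt_of_lt (c.partSize_pos i)⟩ : Fin n) := by
  apply le_antisymm
  · refine Finset.max_le fun x hx => ?_
    obtain ⟨r, rfl⟩ := mem_partFinset.1 hx
    refine WithBot.coe_le_coe.2 ((c.emb_strictMono i).monotone ?_)
    exact Fin.le_def.2 (Nat.le_sub_one_of_lt r.2)
  · exact Finset.le_max (mem_partFinset.2 ⟨_, rfl⟩)

lemma max_partFinset_strictMono (c : OrderedFinpartition n) :
    StrictMono fun i => (c.partFinset i).max := by
  intro i j hij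
  simp only [max_partFinset]
  exact WithBot.coe_lt_coe.2 (c.parts_strictMono hij)

lemma partFinset_injective (c : OrderedFinpartition n) : Function.Injective c.partFinset :=
  fun _ _ h => c.max_partFinset_strictMono.injective (congrArg Finset.max h)

lemma coe_partFinset (c : OrderedFinpartition n) (i : Fin c.length) :
    (c.partFinset i : Set (Fin n)) = range (c.emb i) := by
  simp [partFinset]

/-- The unordered finpartition underlying an ordered finpartition. -/
def toFinpartition (c : OrderedFinpartition n) :
    Finpartition (Finset.univ : Finset (Fin n)) :=
  Finpartition.ofExistsUnique (Finset.univ.image c.partFinset) (fun _ _ => Finset.subset_univ _)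
    (by
      intro x _
      obtain ⟨i, hi⟩ := c.cover x
      refine ⟨c.partFinset i, ⟨by simp, mem_partFinset.2 hi⟩, ?_⟩
      rintro t ⟨ht, hxt⟩
      obtain ⟨j, -, rfl⟩ := Finset.mem_image.1 ht
      obtain ⟨r, rfl⟩ := hi
      obtain ⟨s, hs⟩ := mem_partFinset.1 hxt
      by_contra hne
      exact c.emb_ne_emb_of_ne (fun h : j = i => hne (h ▸ rfl)) hs)
    (by
      intro h
      obtain ⟨i, -, hi⟩ := Finset.mem_image.1 h
      have := c.card_partFinset i
      rw [hi, Finset.card_empty] at this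
      exact (c.partSize_pos i).ne this)

lemma ext_of_partFinset {c d : OrderedFinpartition n} (hl : c.length = d.length)
    (h : ∀ i, c.partFinset i = d.partFinset (Fin.cast hl i)) : c = d := by
  have hs : ∀ i, c.partSize i = d.partSize (Fin.cast hl i) := fun i => by
    rw [← card_partFinset, h, card_partFinset]
  have hr : ∀ i, range (c.emb i) = range (d.emb (Fin.cast hl i)) := fun i => by
    rw [← coe_partFinset, h, coe_partFinset]
  clear h
  cases c with | mk l s hs₀ e he _ _ _
  cases d with | mk l' s' hs₀' e' he' _ _ _
  dsimp only at hl hs hr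
  subst hl
  obtain rfl : s = s' := funext hs
  obtain rfl : e = e' := funext fun i => ((he i).range_inj (he' i)).1 (hr i)
  rfl

lemma toFinpartition_injective :
    Function.Injective (toFinpartition : OrderedFinpartition n → _) := by
  intro c d h
  have hp : Finset.univ.image c.partFinset = Finset.univ.image d.partFinset :=
    congrArg Finpartition.parts h
  have hl : c.length = d.length := by
    have := congrArg Finset.card hp
    rwa [Finset.card_image_of_injective _ c.partFinset_injective,
      Finset.card_image_of_injective _ d.partFinset_injective, Finset.card_fin,
      Finset.card_fin] at this
  have hrange : range c.partFinset = range d.partFinset := by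
    simpa using congrArg (fun s : Finset (Finset (Fin n)) => (s : Set (Finset (Fin n)))) hp
  have hcast : StrictMono (Fin.cast hl) := Fin.cast_strictMono hl
  have hmax : (fun i => (c.partFinset i).max) =
      (fun i => (d.partFinset i).max) ∘ Fin.cast hl := by
    refine (c.max_partFinset_strictMono.range_inj (d.max_partFinset_strictMono.comp hcast)).1 ?_
    rw [(show Function.Surjective (Fin.cast hl) from (finCongr hl).surjective).range_comp
      (fun i => (d.partFinset i).max)]
    change range (Finset.max ∘ c.partFinset) = range (Finset.max ∘ d.partFinset)
    rw [range_comp, hrange, range_comp]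
  refine ext_of_partFinset hl fun i => ?_
  obtain ⟨j, hj⟩ : c.partFinset i ∈ range d.partFinset := hrange ▸ mem_range_self i
  have hi : (c.partFinset i).max = (d.partFinset (Fin.cast hl i)).max := congrFun hmax i
  rw [← hj] at hi ⊢
  rw [d.max_partFinset_strictMono.injective hi]

lemma card_mono {k l : ℕ} (h : k ≤ l) :
    Fintype.card (OrderedFinpartition k) ≤ Fintype.card (OrderedFinpartition l) := by
  refine monotone_nat_of_le_succ
    (f := fun n => Fintype.card (OrderedFinpartition n)) (fun n => ?_) h
  refine Fintype.card_le_of_injective (fun c => extendEquiv n ⟨c, none⟩) fun c d hcd => ?_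
  exact congrArg Sigma.fst ((extendEquiv n).injective hcd)

lemma card_le_card_finpartition {k m : ℕ} (h : k ≤ m) :
    Fintype.card (OrderedFinpartition k) ≤
      Nat.card (Finpartition (Finset.univ : Finset (Fin m))) := by
  refine (card_mono h).trans ?_
  rw [← Nat.card_eq_fintype_card]
  exact Nat.card_le_card_of_injective _ toFinpartition_injective

end OrderedFinpartition

/-- A bound for the iterated derivatives of a composition, in terms of bounds `A` for the outer
function and `B` for the inner one. -/
lemma abs_iteratedDeriv_comp_le {m i : ℕ} (hi : i ≤ m) {ψ g : ℝ → ℝ}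
    (hψ : ContDiff ℝ m ψ) (hg : ContDiff ℝ m g) {A B : ℝ} (hB : 1 ≤ B)
    (hA : ∀ k ≤ m, ∀ t, |iteratedDeriv k ψ t| ≤ A)
    (hgB : ∀ k, 1 ≤ k → k ≤ m → ∀ t, |iteratedDeriv k g t| ≤ B) (t : ℝ) :
    |iteratedDeriv i (ψ ∘ g) t| ≤
      Nat.card (Finpartition (Finset.univ : Finset (Fin m))) * A * B ^ m := by
  have hA₀ : 0 ≤ A := (abs_nonneg _).trans (hA 0 m.zero_le 0)
  rw [iteratedDeriv_comp_eq_sum_orderedFinpartition hψ.contDiffAt hg.contDiffAt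
    (by exact_mod_cast hi)]
  calc
    _ ≤ ∑ _c : OrderedFinpartition i, A * B ^ m := by
      refine (Finset.abs_sum_le_sum_abs _ _).trans (Finset.sum_le_sum fun c _ => ?_)
      rw [abs_mul, Finset.abs_prod]
      have hc : c.length ≤ m := c.length_le.trans hi
      gcongr
      · exact hA _ hc _
      · calc
          _ ≤ ∏ _j : Fin c.length, B := Finset.prod_le_prod (fun _ _ => abs_nonneg _) fun j _ =>
              hgB _ (c.partSize_pos j) ((c.partSize_le j).trans hi) t
          _ = B ^ c.length := by simp
          _ ≤ B ^ m := pow_le_pow_right₀ hB hc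
    _ = Fintype.card (OrderedFinpartition i) * A * B ^ m := by simp [mul_assoc]
    _ ≤ _ := by
      gcongr
      exact_mod_cast OrderedFinpartition.card_le_card_finpartition hi

/-- Faà di Bruno norm estimate: if `g` is `C^m` with `M = sup{|D^i g| : 1 ≤ i ≤ m} < ∞`
and `φ` is `C^m` with `‖φ − id‖_m < ∞`, then
`‖φ∘g − g‖_m ≤ |Π_m| · ‖φ − id‖_m · max(1,M)^m`, where `|Π_m|` is the number of
partitions of `{1,…,m}` (the `m`-th Bell number). -/
theorem statement12 (m : ℕ) (hm : 1 ≤ m) (g φ : ℝ → ℝ)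
    (hg : ContDiff ℝ (m : ℕ∞) g) (hφ : ContDiff ℝ (m : ℕ∞) φ)
    (M : ℝ)
    (hM : M = sSup {y : ℝ | ∃ i : ℕ, 1 ≤ i ∧ i ≤ m ∧ ∃ t : ℝ, y = |iteratedDeriv i g t|})
    (hM_fin : BddAbove {y : ℝ | ∃ i : ℕ, 1 ≤ i ∧ i ≤ m ∧ ∃ t : ℝ, y = |iteratedDeriv i g t|})
    (hφ_fin : BddAbove {y : ℝ | ∃ i ≤ m, ∃ t : ℝ, y = |iteratedDeriv i (fun s => φ s - s) t|}) :
    CmNorm m (fun t => φ (g t) - g t) ≤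
      (Nat.card (Finpartition (Finset.univ : Finset (Fin m))) : ℝ) *
        CmNorm m (fun t => φ t - t) * max 1 M ^ m := by
  refine csSup_le ⟨_, 0, m.zero_le, 0, rfl⟩ ?_
  rintro y ⟨i, hi, t, rfl⟩
  refine abs_iteratedDeriv_comp_le hi (ψ := fun s => φ s - s) (hφ.sub contDiff_id) hg
    (le_max_left 1 M) (fun k hk s => le_csSup hφ_fin ⟨k, hk, s, rfl⟩) (fun k hk hkm s => ?_) t
  exact (hM ▸ le_csSup hM_fin ⟨k, hk, hkm, s, rfl⟩).trans (le_max_right 1 M)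
end

section
/- Let ξ be a C^∞ vector field on [0,∞) with ξ(0) = 0, ξ(x) < 0 for all x > 0, D^m ξ(0) = 0 for all m ≥ 0 (infinitely flat at the origin), and sup |ξ| < ∞ (so ξ is complete). Let f^t denote the flow of ξ and define ψ: ℝ → (0,∞) by ψ(t) = f^t(1). Then ψ is a C^∞ diffeomorphism from ℝ onto (0,∞) with Dψ = ξ∘ψ, and for every integer m ≥ 1, sup{ |D^m ψ(t)| : t ≥ T } → 0 as T → +∞. -/
open Set Filter Topology

/-- A differentiable solution of `ψ' = ξ ∘ ψ` with values in `[0,∞)` is smooth when `ξ` is smooth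
on `[0,∞)`. -/
theorem contDiff_of_hasDerivAt_comp {ξ ψ : ℝ → ℝ}
    (hξ : ContDiffOn ℝ ((⊤ : ℕ∞) : WithTop ℕ∞) ξ (Set.Ici 0))
    (hmem : ∀ t, ψ t ∈ Set.Ici (0 : ℝ)) (hd : ∀ t, HasDerivAt ψ (ξ (ψ t)) t) :
    ContDiff ℝ ((⊤ : ℕ∞) : WithTop ℕ∞) ψ := by
  have hdiff : Differentiable ℝ ψ := fun t => (hd t).differentiableAt
  have hderiv : deriv ψ = ξ ∘ ψ := funext fun t => (hd t).deriv
  refine contDiff_infty.2 fun n => ?_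
  induction n with
  | zero => exact contDiff_zero.2 hdiff.continuous
  | succ n ih =>
    push_cast
    refine contDiff_succ_iff_deriv.2 ⟨hdiff, by simp, ?_⟩
    rw [hderiv]
    exact (hξ.of_le (by exact_mod_cast le_top)).comp_contDiff ih hmem

/-- Every derivative of positive order of a solution of `ψ' = ξ ∘ ψ` is of the form `g ∘ ψ`, with
`g` smooth on `[0,∞)` and vanishing at the zero `0` of `ξ`. -/
theorem exists_iteratedDeriv_eq_comp {ξ ψ : ℝ → ℝ}
    (hξ : ContDiffOn ℝ ((⊤ : ℕ∞) : WithTop ℕ∞) ξ (Set.Ici 0)) (hξ0 : ξ 0 = 0)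
    (hmem : ∀ t, ψ t ∈ Set.Ici (0 : ℝ)) (hd : ∀ t, HasDerivAt ψ (ξ (ψ t)) t) (m : ℕ) :
    ∃ g : ℝ → ℝ, ContDiffOn ℝ ((⊤ : ℕ∞) : WithTop ℕ∞) g (Set.Ici 0) ∧ g 0 = 0 ∧
      iteratedDeriv (m + 1) ψ = g ∘ ψ := by
  induction m with
  | zero => exact ⟨ξ, hξ, hξ0, funext fun t => by simpa using (hd t).deriv⟩
  | succ m ih =>
    obtain ⟨g, hg, -, hgψ⟩ := ih
    refine ⟨fun x => derivWithin g (Set.Ici 0) x * ξ x, ?_, by simp [hξ0], ?_⟩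
    · exact (hg.derivWithin (uniqueDiffOn_Ici 0) (by simp)).mul hξ
    · rw [iteratedDeriv_succ, hgψ]
      funext t
      have hg' := ((hg.differentiableOn (by simp)) (ψ t) (hmem t)).hasDerivWithinAt
      have h := hg'.comp_hasDerivAt t (hd t) (Eventually.of_forall hmem)
      exact h.deriv

/-- A nonnegative solution of `ψ' = ξ ∘ ψ` that starts at `1` stays positive, when `ξ` is smooth
and vanishes at `0`. -/
theorem pos_of_hasDerivAt_comp {ξ ψ : ℝ → ℝ}
    (hξ : ContDiffOn ℝ ((⊤ : ℕ∞) : WithTop ℕ∞) ξ (Set.Ici 0)) (hξ0 : ξ 0 = 0)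
    (hmem : ∀ t, ψ t ∈ Set.Ici (0 : ℝ)) (hd : ∀ t, HasDerivAt ψ (ξ (ψ t)) t)
    (hanti : Antitone ψ) (h1 : ψ 0 = 1) (t : ℝ) : 0 < ψ t := by
  rcases le_total t 0 with ht | ht
  · linarith [hanti ht]
  obtain ⟨K, hK⟩ := (hξ.mono (t := Set.Icc 0 1) fun _ hx => hx.1).exists_lipschitzOnWith
    (by simp) (convex_Icc 0 1) isCompact_Icc
  have hbound : ∀ x ∈ Set.Icc (0 : ℝ) 1, -(K * x) ≤ ξ x := fun x hx => by
    have h := hK.dist_le_mul x hx 0 (by simp)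
    rw [Real.dist_eq, Real.dist_eq, hξ0, sub_zero, sub_zero, abs_of_nonneg hx.1] at h
    exact (abs_le.1 h).1
  have hder : ∀ s, HasDerivAt (fun s => ψ s * Real.exp (K * s))
      (ξ (ψ s) * Real.exp (K * s) + ψ s * (Real.exp (K * s) * (K * 1))) s := fun s =>
    (hd s).mul (((hasDerivAt_id s).const_mul (K : ℝ)).exp)
  have hmono : MonotoneOn (fun s => ψ s * Real.exp (K * s)) (Set.Ici 0) := by
    refine monotoneOn_of_deriv_nonneg (convex_Ici 0)
      (fun s _ => (hder s).continuousAt.continuousWithinAt)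
      (fun s _ => (hder s).differentiableAt.differentiableWithinAt) fun s hs => ?_
    rw [interior_Ici] at hs
    have hle := hanti (le_of_lt hs)
    rw [h1] at hle
    rw [(hder s).deriv]
    have h := mul_nonneg (Real.exp_pos (K * s)).le
      (neg_le_iff_add_nonneg.1 (hbound (ψ s) ⟨hmem s, hle⟩))
    linarith
  have h := hmono (Set.mem_Ici.2 le_rfl) ht ht
  simp only [h1, mul_zero, Real.exp_zero, mul_one] at h
  exact pos_of_mul_pos_left (zero_lt_one.trans_le h) (Real.exp_pos _).le

/-- If `ξ` is continuous and negative on `[a,b]`, solutions of `ψ' = ξ ∘ ψ` decrease at least at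
some constant rate `c > 0` as long as they stay in `[a,b]`. -/
theorem exists_decay_rate {ξ ψ : ℝ → ℝ} {a b : ℝ} (hab : a ≤ b)
    (hξ : ContinuousOn ξ (Set.Icc a b)) (hneg : ∀ x ∈ Set.Icc a b, ξ x < 0)
    (hd : ∀ t, HasDerivAt ψ (ξ (ψ t)) t) :
    ∃ c > 0, ∀ s t, s ≤ t → (∀ u ∈ Set.Icc s t, ψ u ∈ Set.Icc a b) → c * (t - s) ≤ ψ s - ψ t := by
  obtain ⟨x, hx, hmax⟩ := isCompact_Icc.exists_isMaxOn (Set.nonempty_Icc.2 hab) hξ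
  refine ⟨-ξ x, neg_pos.2 (hneg x hx), fun s t hst hu => ?_⟩
  have h := (convex_Icc s t).image_sub_le_mul_sub_of_deriv_le (f := ψ) (C := ξ x)
    (fun u _ => (hd u).continuousAt.continuousWithinAt)
    (fun u _ => (hd u).differentiableAt.differentiableWithinAt)
    (fun u hus => by
      rw [(hd u).deriv]
      exact hmax (hu u (interior_subset hus)))
    s (Set.left_mem_Icc.2 hst) t (Set.right_mem_Icc.2 hst) hst
  linarith

/-- If `ξ` is a smooth, bounded vector field on `[0,∞)`, negative on `(0,∞)` and infinitely
flat at `0`, then `ψ(t) = f^t(1)` is a smooth diffeomorphism from `ℝ` onto `(0,∞)` with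
`Dψ = ξ∘ψ`, and for every `m ≥ 1` the supremum of `|D^m ψ|` over `[T,∞)` tends to `0` as
`T → +∞`. -/
theorem statement13 (ξ : ℝ → ℝ)
    (hξ_smooth : ContDiffOn ℝ ((⊤ : ℕ∞) : WithTop ℕ∞) ξ (Set.Ici 0))
    (hξ0 : ξ 0 = 0) (hξ_neg : ∀ x : ℝ, 0 < x → ξ x < 0)
    (hξ_flat : ∀ m : ℕ, iteratedDerivWithin m ξ (Set.Ici 0) 0 = 0)
    (hξ_bdd : ∃ C : ℝ, ∀ x ∈ Set.Ici (0 : ℝ), |ξ x| ≤ C)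
    (F : ℝ → ℝ → ℝ) (hF : IsFlowOf ξ F)
    (ψ : ℝ → ℝ) (hψ : ∀ t : ℝ, ψ t = F t 1) :
    ContDiff ℝ ((⊤ : ℕ∞) : WithTop ℕ∞) ψ ∧
    Set.BijOn ψ Set.univ (Set.Ioi 0) ∧
    (∀ t : ℝ, deriv ψ t = ξ (ψ t)) ∧
    (∀ t : ℝ, deriv ψ t ≠ 0) ∧
    (∀ m : ℕ, 1 ≤ m → ∀ ε : ℝ, 0 < ε →
      ∃ T : ℝ, ∀ t : ℝ, T ≤ t → |iteratedDeriv m ψ t| < ε) := by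
  have hmem : ∀ t, ψ t ∈ Set.Ici (0 : ℝ) := fun t => by
    rw [hψ]
    exact ((hF 1 (by simp)).2 t).1
  have h1 : ψ 0 = 1 := by
    rw [hψ]
    exact (hF 1 (by simp)).1
  have hd : ∀ t, HasDerivAt ψ (ξ (ψ t)) t := fun t => by
    rw [funext hψ]
    exact ((hF 1 (by simp)).2 t).2
  have hanti : Antitone ψ := antitone_of_deriv_nonpos (fun t => (hd t).differentiableAt)
    fun t => by
      rw [(hd t).deriv]
      rcases (Set.mem_Ici.1 (hmem t)).eq_or_lt with h | h
      · rw [← h, hξ0]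
      · exact (hξ_neg _ h).le
  have hpos : ∀ t, 0 < ψ t := pos_of_hasDerivAt_comp hξ_smooth hξ0 hmem hd hanti h1
  have hstrict : StrictAnti ψ := strictAnti_of_deriv_neg fun t => by
    rw [(hd t).deriv]
    exact hξ_neg _ (hpos t)
  have hcont : Continuous ψ := continuous_iff_continuousAt.2 fun t => (hd t).continuousAt
  have hdecay : ∀ a b : ℝ, 0 < a → a ≤ b → ∃ c > 0, ∀ s t, s ≤ t →
      (∀ u ∈ Set.Icc s t, ψ u ∈ Set.Icc a b) → c * (t - s) ≤ ψ s - ψ t := fun a b ha hab =>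
    exists_decay_rate hab
      (hξ_smooth.continuousOn.mono fun x hx => ha.le.trans hx.1)
      (fun x hx => hξ_neg x (ha.trans_le hx.1)) hd
  have hsmall : ∀ a : ℝ, 0 < a → ∃ t, ψ t < a := fun a ha => by
    by_contra! h
    obtain ⟨c, hc, hlin⟩ := hdecay a 1 ha (h1 ▸ h 0)
    have h' := hlin 0 (1 / c) (by positivity) fun u hu => ⟨h u, h1 ▸ hanti hu.1⟩
    rw [sub_zero, mul_one_div_cancel hc.ne', h1] at h'
    linarith [hpos (1 / c)]
  have hlarge : ∀ b : ℝ, ∃ t, b < ψ t := fun b => by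
    by_contra! h
    have hb : 1 ≤ b := h1 ▸ h 0
    obtain ⟨c, hc, hlin⟩ := hdecay 1 b one_pos hb
    have h' := hlin (-(b / c)) 0 (neg_nonpos.2 (by positivity))
      fun u hu => ⟨h1 ▸ hanti hu.2, h u⟩
    rw [zero_sub, neg_neg, mul_div_cancel₀ _ hc.ne', h1] at h'
    linarith [h (-(b / c))]
  have hlim : Tendsto ψ atTop (𝓝[Set.Ici 0] 0) := by
    refine tendsto_nhdsWithin_iff.2 ⟨Metric.tendsto_atTop.2 fun ε hε => ?_,
      Eventually.of_forall hmem⟩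
    obtain ⟨T, hT⟩ := hsmall ε hε
    refine ⟨T, fun t ht => ?_⟩
    rw [Real.dist_eq, sub_zero, abs_of_pos (hpos t)]
    exact (hanti ht).trans_lt hT
  refine ⟨contDiff_of_hasDerivAt_comp hξ_smooth hmem hd,
    ⟨fun t _ => hpos t, hstrict.injective.injOn, fun y hy => ?_⟩, fun t => (hd t).deriv,
    fun t => (hd t).deriv ▸ (hξ_neg _ (hpos t)).ne, fun m hm ε hε => ?_⟩
  · obtain ⟨s, hs⟩ := hsmall y hy
    obtain ⟨t, ht⟩ := hlarge y
    obtain ⟨u, hu⟩ := mem_range_of_exists_le_of_exists_ge hcont ⟨s, hs.le⟩ ⟨t, ht.le⟩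
    exact ⟨u, Set.mem_univ u, hu⟩
  · obtain ⟨n, rfl⟩ := Nat.exists_eq_add_of_le' hm
    obtain ⟨g, hg, hg0, hgψ⟩ := exists_iteratedDeriv_eq_comp hξ_smooth hξ0 hmem hd n
    have hg_lim : Tendsto (g ∘ ψ) atTop (𝓝 0) := by
      have h := hg.continuousOn 0 (Set.mem_Ici.2 le_rfl)
      rw [ContinuousWithinAt, hg0] at h
      exact h.comp hlim
    obtain ⟨T, hT⟩ := Metric.tendsto_atTop.1 hg_lim ε hε
    refine ⟨T, fun t ht => ?_⟩
    rw [hgψ, ← sub_zero ((g ∘ ψ) t), ← Real.dist_eq]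
    exact hT t ht
end

section
/- Let f_0 be a C^∞ diffeomorphism of [0,∞) with f_0(0) = 0 and 0 < f_0(x) < x for all x > 0. If f_0 satisfies the oscillation condition limsup_{x→0⁺} ( sup_{0<y≤x} |log(x − f_0(x))| / |log(y − f_0(y))| ) = +∞, then f_0 is infinitely tangent to the identity at the origin, i.e. D^m(f_0 − id)(0) = 0 for every integer m ≥ 0. -/
open Set Filter Topology

/-- A function which is smooth on the half-line and has a nonzero derivative of some order at `0`
has, near `0`, the size of a monomial. -/
theorem exists_monomial_bounds {g : ℝ → ℝ} (hg : ContDiffOn ℝ (⊤ : ℕ∞) g (Ici 0)) {m : ℕ}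
    (hm : iteratedDerivWithin m g (Ici 0) 0 ≠ 0) :
    ∃ k : ℕ, ∃ b : ℝ, 0 < b ∧ ∀ᶠ x in 𝓝[Ici 0] (0 : ℝ),
      b * x ^ k ≤ |g x| ∧ |g x| ≤ 3 * b * x ^ k := by
  classical
  have hex : ∃ k, iteratedDerivWithin k g (Ici 0) 0 ≠ 0 := ⟨m, hm⟩
  obtain ⟨k, hk, hlt⟩ : ∃ k, iteratedDerivWithin k g (Ici 0) 0 ≠ 0 ∧
      ∀ j < k, iteratedDerivWithin j g (Ici 0) 0 = 0 :=
    ⟨Nat.find hex, Nat.find_spec hex, fun j hj => not_not.mp (Nat.find_min hex hj)⟩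
  set a := iteratedDerivWithin k g (Ici 0) 0 / k.factorial with ha
  have ha0 : a ≠ 0 := div_ne_zero hk (by positivity)
  have htaylor (x : ℝ) : taylorWithinEval g k (Ici 0) 0 x = a * x ^ k := by
    rw [taylor_within_apply, Finset.sum_range_succ, Finset.sum_eq_zero]
    · simp only [sub_zero, zero_add, smul_eq_mul, ha]
      ring
    · intro j hj
      simp [hlt j (Finset.mem_range.mp hj)]
  have ho := taylor_isLittleO (convex_Ici (0 : ℝ)) self_mem_Ici
    (hg.of_le (by exact_mod_cast le_top) : ContDiffOn ℝ k g (Ici 0))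
  refine ⟨k, |a| / 2, by positivity, ?_⟩
  filter_upwards [ho.def (show 0 < |a| / 2 by positivity), self_mem_nhdsWithin] with x hx hx0
  have hxk : 0 ≤ x ^ k := pow_nonneg hx0 k
  rw [htaylor, sub_zero, Real.norm_eq_abs, Real.norm_eq_abs, abs_of_nonneg hxk] at hx
  have habs : |a * x ^ k| = |a| * x ^ k := by rw [abs_mul, abs_of_nonneg hxk]
  have h₁ := abs_sub_abs_le_abs_sub (g x) (a * x ^ k)
  have h₂ := abs_sub_abs_le_abs_sub (a * x ^ k) (g x)
  rw [abs_sub_comm] at h₂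
  constructor <;> linarith

/-- A smooth contracting diffeomorphism of `[0,∞)` satisfying the oscillation condition is
infinitely tangent to the identity at the origin. -/
theorem statement14 (f₀ : ℝ → ℝ)
    (hf₀ : CrHalfLineDiffeo ⊤ f₀) (hf₀0 : f₀ 0 = 0)
    (hf₀_contr : ∀ x : ℝ, 0 < x → 0 < f₀ x ∧ f₀ x < x)
    -- the oscillation condition:
    -- `limsup_{x→0⁺} sup_{0<y≤x} |log(x−f₀x)|/|log(y−f₀y)| = +∞`
    (hosc : ∀ M : ℝ, ∀ ε : ℝ, 0 < ε → ∃ x : ℝ, 0 < x ∧ x < ε ∧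
      ∃ y : ℝ, 0 < y ∧ y ≤ x ∧
        M < |Real.log (x - f₀ x)| / |Real.log (y - f₀ y)|) :
    ∀ m : ℕ, iteratedDerivWithin m (fun x => f₀ x - x) (Set.Ici 0) 0 = 0 := by
  by_contra! hne
  obtain ⟨m, hm⟩ := hne
  have hg : ContDiffOn ℝ (⊤ : ℕ∞) (fun x => f₀ x - x) (Ici 0) := hf₀.2.sub contDiffOn_id
  obtain ⟨k, b, hb, hbd⟩ := exists_monomial_bounds hg hm
  have hlim : Tendsto (fun x => f₀ x - x) (𝓝[Ici 0] (0 : ℝ)) (𝓝 0) := by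
    simpa [ContinuousWithinAt, hf₀0] using hg.continuousOn 0 self_mem_Ici
  have hev := hbd.and ((tendsto_order.mp hlim).1 (-(1 / 9)) (by norm_num))
  obtain ⟨ε, hε, hball⟩ := Metric.mem_nhdsWithin_iff.mp hev
  obtain ⟨x, hx, hxε, y, hy, hyx, hlt⟩ := hosc 2 ε hε
  have key (z : ℝ) (hz : 0 < z) (hzx : z ≤ x) :
      0 < z - f₀ z ∧ z - f₀ z < 1 / 9 ∧ b * z ^ k ≤ z - f₀ z ∧ z - f₀ z ≤ 3 * b * z ^ k := by
    have hz' : z ∈ Metric.ball 0 ε ∩ Ici 0 := by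
      refine ⟨?_, hz.le⟩
      rw [Metric.mem_ball, Real.dist_0_eq_abs, abs_of_pos hz]
      exact hzx.trans_lt hxε
    have h := hball hz'
    simp only [mem_ofPred_eq] at h
    have hpos := (hf₀_contr z hz).2
    rw [abs_of_neg (sub_neg.mpr hpos), neg_sub] at h
    exact ⟨sub_pos.mpr hpos, by linarith [h.2], h.1⟩
  obtain ⟨hx0, hx1, hxb, -⟩ := key x hx le_rfl
  obtain ⟨hy0, hy1, -, hyb⟩ := key y hy hyx
  have hpow : y ^ k ≤ x ^ k := pow_le_pow_left₀ hy.le hyx k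
  have hcmp : (y - f₀ y) ^ 2 ≤ x - f₀ x := by
    have : b * y ^ k ≤ b * x ^ k := by gcongr
    nlinarith
  have hlog := Real.log_le_log (by positivity) hcmp
  rw [Real.log_pow] at hlog
  have hlx := Real.log_neg hx0 (by linarith)
  have hly := Real.log_neg hy0 (by linarith)
  rw [abs_of_neg hlx, abs_of_neg hly, lt_div_iff₀ (by linarith)] at hlt
  push_cast at hlog
  linarith
end

section
/- Let ξ be a C^∞ vector field on [0,∞) with ξ(0) = 0, ξ(x) < 0 for x > 0, D^m ξ(0) = 0 for all m ≥ 0, and sup |ξ| < ∞. Let f^t denote the flow of ξ, ψ(t) = f^t(1), and ψ^{-1}: (0,∞) → ℝ the inverse diffeomorphism (so Dψ^{-1} = 1/ξ on (0,∞)). Let ([b_n, c_n])_{n≥1} be a sequence of compact intervals contained in (0,∞) with c_n → 0 as n → ∞, and set v_n = inf_{x∈[b_n,c_n]} |ξ(x)| > 0. Then for every integer m ≥ 1, v_n^{m+1} · sup{ |D^m ψ^{-1}(x)| : x ∈ [b_n, c_n] } → 0 as n → ∞. -/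
open Set Filter Topology

/-- The numerator of `D^k (1/ξ) = P_k / ξ^(k+1)`: a polynomial in the derivatives of `ξ`. -/
noncomputable def invNumerator (ξ : ℝ → ℝ) : ℕ → ℝ → ℝ
  | 0 => fun _ => 1
  | k + 1 => fun x => ξ x * derivWithin (invNumerator ξ k) (Set.Ici 0) x
      - (k + 1 : ℝ) * derivWithin ξ (Set.Ici 0) x * invNumerator ξ k x

theorem contDiffOn_invNumerator {ξ : ℝ → ℝ}
    (hξ : ContDiffOn ℝ ((⊤ : ℕ∞) : WithTop ℕ∞) ξ (Set.Ici 0)) (k : ℕ) :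
    ContDiffOn ℝ ((⊤ : ℕ∞) : WithTop ℕ∞) (invNumerator ξ k) (Set.Ici 0) := by
  have hd : ∀ f : ℝ → ℝ, ContDiffOn ℝ ((⊤ : ℕ∞) : WithTop ℕ∞) f (Set.Ici 0) →
      ContDiffOn ℝ ((⊤ : ℕ∞) : WithTop ℕ∞) (derivWithin f (Set.Ici 0)) (Set.Ici 0) :=
    fun f hf => hf.derivWithin (uniqueDiffOn_Ici 0) le_rfl
  induction k with
  | zero => exact contDiffOn_const
  | succ k ih => exact (hξ.mul (hd _ ih)).sub ((contDiffOn_const.mul (hd _ hξ)).mul ih)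

theorem ContDiffOn.hasDerivAt_derivWithin_Ici {f : ℝ → ℝ}
    (hf : ContDiffOn ℝ ((⊤ : ℕ∞) : WithTop ℕ∞) f (Set.Ici 0)) {x : ℝ} (hx : 0 < x) :
    HasDerivAt f (derivWithin f (Set.Ici 0) x) x :=
  ((hf.differentiableOn (by simp)) x hx.le).hasDerivWithinAt.hasDerivAt (Ici_mem_nhds hx)

/-- If `Dg = 1/ξ` on `(0,∞)`, the higher derivatives of `g` are given by `invNumerator`. -/
theorem iteratedDeriv_eq_invNumerator_div {ξ g : ℝ → ℝ}
    (hξ : ContDiffOn ℝ ((⊤ : ℕ∞) : WithTop ℕ∞) ξ (Set.Ici 0))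
    (hneg : ∀ x : ℝ, 0 < x → ξ x < 0)
    (hg : ∀ x : ℝ, 0 < x → HasDerivAt g (ξ x)⁻¹ x) (k : ℕ) :
    ∀ x : ℝ, 0 < x → iteratedDeriv (k + 1) g x = invNumerator ξ k x / ξ x ^ (k + 1) := by
  induction k with
  | zero =>
    intro x hx
    simp [iteratedDeriv_one, (hg x hx).deriv, invNumerator]
  | succ k ih =>
    intro x hx
    have h0 : ξ x ≠ 0 := (hneg x hx).ne
    have hev : iteratedDeriv (k + 1) g =ᶠ[𝓝 x] fun y => invNumerator ξ k y / ξ y ^ (k + 1) := by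
      filter_upwards [Ioi_mem_nhds hx] with y hy using ih y hy
    have hP := (contDiffOn_invNumerator hξ k).hasDerivAt_derivWithin_Ici hx
    have hQ := hP.fun_div ((hξ.hasDerivAt_derivWithin_Ici hx).fun_pow (k + 1)) (pow_ne_zero _ h0)
    rw [iteratedDeriv_succ, hev.deriv_eq, hQ.deriv]
    simp only [invNumerator, Nat.add_sub_cancel, Nat.cast_add, Nat.cast_one]
    field_simp
    ring

/-- The time parametrization of an orbit inside `[0,∞)` has inverse with derivative `1/ξ`. -/
theorem hasDerivAt_inverse_of_orbit {ξ ψ ψinv : ℝ → ℝ} (hξ0 : ξ 0 = 0)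
    (hneg : ∀ x : ℝ, 0 < x → ξ x < 0) (hnonneg : ∀ t, 0 ≤ ψ t)
    (hψ : ∀ t, HasDerivAt ψ (ξ (ψ t)) t) (hleft : ∀ t, ψinv (ψ t) = t)
    (hright : ∀ x ∈ Set.Ioi (0 : ℝ), ψ (ψinv x) = x) {x : ℝ} (hx : 0 < x) :
    HasDerivAt ψinv (ξ x)⁻¹ x := by
  have hanti : Antitone ψ := by
    refine antitone_of_deriv_nonpos (fun t => (hψ t).differentiableAt) fun t => ?_
    rw [(hψ t).deriv]
    rcases (hnonneg t).eq_or_lt with h | h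
    · rw [← h, hξ0]
    · exact (hneg _ h).le
  have hstrict : StrictAnti ψ :=
    hanti.strictAnti_of_injective (Function.LeftInverse.injective hleft)
  have hpos : ∀ t, 0 < ψ t := fun t =>
    (hnonneg (t + 1)).trans_lt (hstrict (lt_add_one t))
  have hmono : StrictMonoOn (fun y => -ψinv y) (Set.Ioi 0) := by
    intro y hy z hz hyz
    rw [← hright y hy, ← hright z hz] at hyz
    exact neg_lt_neg (hstrict.lt_iff_gt.1 hyz)
  have himage : (fun y => -ψinv y) '' Set.Ioi 0 = Set.univ := by
    refine Set.eq_univ_of_forall fun t => ⟨ψ (-t), hpos _, ?_⟩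
    simp [hleft]
  have hcont : ContinuousAt ψinv x := by
    have h := hmono.continuousAt_of_image_mem_nhds (Ioi_mem_nhds hx)
      (by rw [himage]; exact Filter.univ_mem)
    exact h.neg.congr (Filter.Eventually.of_forall fun y => neg_neg (ψinv y))
  have hd := hψ (ψinv x)
  rw [hright x hx] at hd
  refine hd.of_local_left_inverse hcont (hneg x hx).ne ?_
  filter_upwards [Ioi_mem_nhds hx] with y hy using hright y hy

/-- With `ξ`, `ψ` as in the previous lemma and `ψ⁻¹ : (0,∞) → ℝ` the inverse diffeomorphism,
for any sequence of compact intervals `[b_n, c_n] ⊂ (0,∞)` with `c_n → 0`, setting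
`v_n = inf_{[b_n,c_n]} |ξ| > 0`, one has
`v_n^{m+1} · sup_{[b_n,c_n]} |D^m ψ⁻¹| → 0` for every `m ≥ 1`. -/
theorem statement15 (ξ : ℝ → ℝ)
    (hξ_smooth : ContDiffOn ℝ ((⊤ : ℕ∞) : WithTop ℕ∞) ξ (Set.Ici 0))
    (hξ0 : ξ 0 = 0) (hξ_neg : ∀ x : ℝ, 0 < x → ξ x < 0)
    (hξ_flat : ∀ m : ℕ, iteratedDerivWithin m ξ (Set.Ici 0) 0 = 0)
    (hξ_bdd : ∃ C : ℝ, ∀ x ∈ Set.Ici (0 : ℝ), |ξ x| ≤ C)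
    (F : ℝ → ℝ → ℝ) (hF : IsFlowOf ξ F)
    (ψ : ℝ → ℝ) (hψ : ∀ t : ℝ, ψ t = F t 1)
    (ψinv : ℝ → ℝ)
    (hψinv_left : ∀ t : ℝ, ψinv (ψ t) = t)
    (hψinv_right : ∀ x ∈ Set.Ioi (0 : ℝ), ψ (ψinv x) = x)
    (b c : ℕ → ℝ) (hbc : ∀ n, 0 < b n ∧ b n ≤ c n)
    (hc0 : Filter.Tendsto c Filter.atTop (𝓝 0))
    (v : ℕ → ℝ)
    (hv : ∀ n, v n = sInf {y : ℝ | ∃ x ∈ Set.Icc (b n) (c n), y = |ξ x|}) :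
    (∀ n, 0 < v n) ∧
    ∀ m : ℕ, 1 ≤ m →
      Filter.Tendsto (fun n => v n ^ (m + 1) *
          sSup {y : ℝ | ∃ x ∈ Set.Icc (b n) (c n), y = |iteratedDeriv m ψinv x|})
        Filter.atTop (𝓝 0) := by
  have hcont : ContinuousOn ξ (Set.Ici 0) := hξ_smooth.continuousOn
  have hsub : ∀ n, Set.Icc (b n) (c n) ⊆ Set.Ici 0 := fun n x hx => (hbc n).1.le.trans hx.1
  have hv_le : ∀ n, ∀ x ∈ Set.Icc (b n) (c n), v n ≤ |ξ x| := by
    intro n x hx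
    rw [hv n]
    refine csInf_le ⟨0, ?_⟩ ⟨x, hx, rfl⟩
    rintro y ⟨z, -, rfl⟩
    exact abs_nonneg _
  have hv_pos : ∀ n, 0 < v n := by
    intro n
    have hne : (Set.Icc (b n) (c n)).Nonempty := Set.nonempty_Icc.2 (hbc n).2
    obtain ⟨z, hz, hmin⟩ := isCompact_Icc.exists_isMinOn hne (hcont.mono (hsub n)).abs
    have hzpos : 0 < |ξ z| := abs_pos.2 (hξ_neg z ((hbc n).1.trans_le hz.1)).ne
    refine hzpos.trans_le ?_
    rw [hv n]
    refine le_csInf ⟨_, z, hz, rfl⟩ ?_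
    rintro y ⟨w, hw, rfl⟩
    exact hmin hw
  refine ⟨hv_pos, fun m hm => ?_⟩
  obtain ⟨k, rfl⟩ : ∃ k, m = k + 1 := ⟨m - 1, by omega⟩
  have hψ' : ψ = fun t => F t 1 := funext hψ
  have hg : ∀ x : ℝ, 0 < x → HasDerivAt ψinv (ξ x)⁻¹ x := by
    intro x hx
    have hF1 := (hF 1 (Set.mem_Ici.2 zero_le_one)).2
    refine hasDerivAt_inverse_of_orbit hξ0 hξ_neg (ψ := ψ) (fun t => ?_) (fun t => ?_)
      hψinv_left hψinv_right hx
    · rw [hψ t]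
      exact (hF1 t).1
    · rw [hψ']
      exact (hF1 t).2
  have hformula := iteratedDeriv_eq_invNumerator_div hξ_smooth hξ_neg hg k
  obtain ⟨M, hM⟩ := (isCompact_Icc (a := (0 : ℝ)) (b := 1)).exists_bound_of_continuousOn
    ((contDiffOn_invNumerator hξ_smooth k).continuousOn.mono Set.Icc_subset_Ici_self)
  have hξc : Tendsto (fun n => |ξ (c n)| * M) atTop (𝓝 0) := by
    have h0 : Tendsto c atTop (𝓝[Set.Ici 0] 0) :=
      tendsto_nhdsWithin_iff.2 ⟨hc0, Eventually.of_forall fun n =>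
        hsub n (Set.right_mem_Icc.2 (hbc n).2)⟩
    have h1 : Tendsto (fun n => ξ (c n)) atTop (𝓝 (ξ 0)) :=
      (hcont 0 Set.self_mem_Ici).tendsto.comp h0
    simpa [hξ0] using h1.abs.mul_const M
  have hM0 : 0 ≤ M := (norm_nonneg _).trans (hM 0 (Set.left_mem_Icc.2 zero_le_one))
  refine squeeze_zero' (Eventually.of_forall fun n => ?_) ?_ hξc
  · refine mul_nonneg (pow_nonneg (hv_pos n).le _) (Real.sSup_nonneg ?_)
    rintro y ⟨x, -, rfl⟩
    exact abs_nonneg _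
  filter_upwards [hc0.eventually (gt_mem_nhds zero_lt_one)] with n hn
  have hvn := hv_pos n
  have hsup : sSup {y : ℝ | ∃ x ∈ Set.Icc (b n) (c n), y = |iteratedDeriv (k + 1) ψinv x|}
      ≤ M / v n ^ (k + 1) := by
    refine csSup_le ⟨_, c n, Set.right_mem_Icc.2 (hbc n).2, rfl⟩ ?_
    rintro y ⟨x, hx, rfl⟩
    have hx0 : 0 < x := (hbc n).1.trans_le hx.1
    rw [hformula x hx0, abs_div, abs_pow]
    exact div_le_div₀ hM0 (hM x ⟨hx0.le, hx.2.trans hn.le⟩) (pow_pos hvn _)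
      (pow_le_pow_left₀ hvn.le (hv_le n x hx) _)
  calc v n ^ (k + 1 + 1) * _ ≤ v n ^ (k + 1 + 1) * (M / v n ^ (k + 1)) :=
        mul_le_mul_of_nonneg_left hsup (pow_nonneg hvn.le _)
    _ = v n * M := by
        field_simp
        ring
    _ ≤ |ξ (c n)| * M :=
        mul_le_mul_of_nonneg_right (hv_le n _ (Set.right_mem_Icc.2 (hbc n).2)) hM0
end
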